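/- arXiv:2407.13396 — 2 statements merged into one kernel-verified Lean document; each statement's English description precedes it below -/
import Mathlib

section
/- Let H ⊂ H² be a hypercycle with base line B and signed distance l from B, and let H⁻ ⊂ H² be the set of points at signed distance at most l from B. Let C ⊂ H² be a circular line with centre o, radius r, and with o at signed distance c from B. Then C ∩ H ≠ ∅ if and only if |c − l| ≤ r. If this inequality is satisfied, then the half central angle ω of the arc C ∩ H⁻ of C satisfies sinh l = cosh r · sinh c − sinh r · cosh c · cos ω. -/
open Metric Set Filter

namespace BallChar

/-- `X` is (isometric to) the `d`-dimensional round sphere of radius 1,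
with the intrinsic (great-circle) metric. -/
def IsSphereSpace (X : Type*) [MetricSpace X] (d : ℕ) : Prop :=
  ∃ e : X → EuclideanSpace ℝ (Fin (d + 1)),
    Function.Injective e ∧
    Set.range e = Metric.sphere (0 : EuclideanSpace ℝ (Fin (d + 1))) 1 ∧
    ∀ x y : X, dist x y = Real.arccos (@inner ℝ _ _ (e x) (e y))

/-- `X` is (isometric to) the `d`-dimensional Euclidean space. -/
def IsEuclideanSpaceForm (X : Type*) [MetricSpace X] (d : ℕ) : Prop :=
  Nonempty (X ≃ᵢ EuclideanSpace ℝ (Fin d))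

/-- The Minkowski bilinear form on `ℝ^d × ℝ`. -/
noncomputable def mink (d : ℕ) (u v : EuclideanSpace ℝ (Fin d) × ℝ) : ℝ :=
  @inner ℝ _ _ u.1 v.1 - u.2 * v.2

/-- `X` is (isometric to) the `d`-dimensional hyperbolic space of curvature `-1`
(the hyperboloid model). -/
def IsHyperbolicSpace (X : Type*) [MetricSpace X] (d : ℕ) : Prop :=
  ∃ e : X → EuclideanSpace ℝ (Fin d) × ℝ,
    Function.Injective e ∧
    Set.range e = {u | mink d u u = -1 ∧ 0 < u.2} ∧
    ∀ x y : X, Real.cosh (dist x y) = - mink d (e x) (e y)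

/-- `X` is `S^d`, `ℝ^d` or `H^d`. -/
def IsSpaceForm (X : Type*) [MetricSpace X] (d : ℕ) : Prop :=
  IsSphereSpace X d ∨ IsEuclideanSpaceForm X d ∨ IsHyperbolicSpace X d

variable {X : Type*} [MetricSpace X]

/-- Metric betweenness: `z` lies on a shortest geodesic from `x` to `y`. -/
def Btw (x z y : X) : Prop := dist x z + dist z y = dist x y

/-- `z` is the unique point between `x` and `y` at its distance from `x`. -/
def UniqueBtwPt (x z y : X) : Prop :=
  Btw x z y ∧ ∀ w, Btw x w y → dist x w = dist x z → w = z

/-- Geodesic convexity (for two antipodal points of a sphere no condition is imposed). -/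
def GConvex (K : Set X) : Prop :=
  ∀ x ∈ K, ∀ y ∈ K, ∀ z, UniqueBtwPt x z y → z ∈ K

/-- `p` is a (metric) midpoint of `x` and `y`. -/
def IsMidpoint (p x y : X) : Prop := Btw x p y ∧ dist x p = dist p y

/-- A reflection in a hyperplane: a non-trivial involutive isometry whose
non-fixed locus is disconnected (by the mirror hyperplane). -/
def IsReflection (σ : X ≃ᵢ X) : Prop :=
  σ.trans σ = IsometryEquiv.refl X ∧ σ ≠ IsometryEquiv.refl X ∧
    ¬ IsPreconnected {x : X | σ x ≠ x}

/-- An orientation preserving congruence: a product of an even number of reflections. -/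
def OrientationPreserving (f : X ≃ᵢ X) : Prop :=
  ∃ l : List (X ≃ᵢ X), (∀ σ ∈ l, IsReflection σ) ∧ Even l.length ∧
    f = l.foldr IsometryEquiv.trans (IsometryEquiv.refl X)

/-- Two subsets are congruent if some isometry of the space maps one onto the other. -/
def Congruent (A B : Set X) : Prop := ∃ f : X ≃ᵢ X, ⇑f '' A = B

/-- `S` admits some non-trivial congruence. -/
def AdmitsNontrivialCongruence (S : Set X) : Prop :=
  ∃ f : X ≃ᵢ X, f ≠ IsometryEquiv.refl X ∧ ⇑f '' S = S

/-- `S` is axially symmetric (symmetric with respect to some reflection). -/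
def AxiallySymmetric (S : Set X) : Prop :=
  ∃ σ : X ≃ᵢ X, IsReflection σ ∧ ⇑σ '' S = S

/-- `S` is centrally symmetric: some involutive isometry fixing a point `p`
maps `S` onto itself, `p` being a midpoint of every pair `x`, `σ x` of `S`. -/
def CentrallySymmetric (S : Set X) : Prop :=
  ∃ (σ : X ≃ᵢ X) (p : X), Function.Involutive ⇑σ ∧ σ p = p ∧ ⇑σ '' S = S ∧
    ∀ x ∈ S, IsMidpoint p x (σ x)

/-- `S` is symmetric with respect to the orthogonal bisector hyperplane of
the segment `[a, b]`, i.e. invariant under the reflection interchanging `a` and `b`. -/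
def SymmetricWrtPerpBisector (S : Set X) (a b : X) : Prop :=
  ∃ σ : X ≃ᵢ X, IsReflection σ ∧ σ a = b ∧ ⇑σ '' S = S

/-- A closed half-space: one of the two closed sides of the mirror of a reflection. -/
def IsHalfspace (P : Set X) : Prop :=
  ∃ σ : X ≃ᵢ X, IsReflection σ ∧ IsClosed P ∧
    P ∪ ⇑σ '' P = univ ∧ P ∩ ⇑σ '' P = {x | σ x = x}

/-- A hyperplane: the mirror (fixed point set) of a reflection. -/
def IsHyperplane (B : Set X) : Prop :=
  ∃ σ : X ≃ᵢ X, IsReflection σ ∧ B = {x | σ x = x}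

/-- A paraball (horoball): a sublevel set of a Busemann function. -/
def IsParaball (K : Set X) : Prop :=
  ∃ γ : ℝ → X, Isometry γ ∧
    K = {x | ∃ b ≤ 0, Tendsto (fun t => dist x (γ t) - t) atTop (nhds b)}

/-- A parasphere (horosphere): the boundary of a paraball. -/
def IsParasphere (C : Set X) : Prop := ∃ K : Set X, IsParaball K ∧ C = frontier K

/-- A hypersphere at distance `lam > 0` from its base hyperplane
(degeneration to a hyperplane excluded). -/
def IsHypersphere (C : Set X) (lam : ℝ) : Prop :=
  0 < lam ∧ (∃ P : Set X, IsHalfspace P ∧ C = frontier {x | infDist x P ≤ lam}) ∧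
    ¬ IsHyperplane C

/-- The family of connected components of the boundary of `K`. -/
def bdryComponents (K : Set X) : Set (Set X) :=
  (connectedComponentIn (frontier K)) '' (frontier K)

/-- `closedBall p r` is an inball of `M` (a ball of maximal radius contained in `M`). -/
def IsInball (M : Set X) (p : X) (r : ℝ) : Prop :=
  0 ≤ r ∧ closedBall p r ⊆ M ∧ ∀ (q : X) (s : ℝ), closedBall q s ⊆ M → s ≤ r

/-- `closedBall p r` is the unique inball of `M`. -/
def HasUniqueInball (M : Set X) (p : X) (r : ℝ) : Prop :=
  IsInball M p r ∧ ∀ (q : X) (s : ℝ), IsInball M q s → q = p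

/-- The (geodesic) convex hull of a set. -/
def gconvexHull (Y : Set X) : Set X := ⋂₀ {C : Set X | GConvex C ∧ Y ⊆ C}

/-- `z` lies on the complete geodesic line through `a` and `b`. -/
def OnLine (a b z : X) : Prop := Btw a z b ∨ Btw z a b ∨ Btw a b z

/-- The closed `(d-1)`-ball of radius `ε` centred at `a` in the hyperplane through `a`
orthogonal to the segment `[a, b]`. -/
def perpDisc (a b : X) (ε : ℝ) : Set X :=
  {x | (∀ z, OnLine a b z → dist x a ≤ dist x z) ∧ dist x a ≤ ε}

/-- The set `D(ε)` associated to the segment `D = [a, b]`: the convex hull of the two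
`(d-1)`-balls of radius `ε` orthogonal to `D` at its endpoints. -/
def segCyl (a b : X) (ε : ℝ) : Set X :=
  gconvexHull (perpDisc a b ε ∪ perpDisc b a ε)

/-- `[a, b]` is the unique diametral segment of `M`. -/
def UniqueDiametral (M : Set X) (a b : X) : Prop :=
  a ∈ M ∧ b ∈ M ∧ a ≠ b ∧ dist a b = diam M ∧
    ∀ a' ∈ M, ∀ b' ∈ M, dist a' b' = diam M → (a' = a ∧ b' = b) ∨ (a' = b ∧ b' = a)

/-- Condition (**): at every boundary point, `K` contains a ball having this point
on its boundary. -/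
def CondBallInside (K : Set X) : Prop :=
  ∀ x ∈ frontier K, ∃ ε > 0, ∃ p : X, closedBall p ε ⊆ K ∧ x ∈ sphere p ε

/-- `K` has an extreme point. -/
def HasExtremePoint (K : Set X) : Prop :=
  ∃ x ∈ K, ∀ y ∈ K, ∀ z ∈ K, Btw y x z → x = y ∨ x = z

/-- Condition (***): near every boundary point, `K` is contained in a ball
(resp. in a convex set bounded by a hypersphere, for hyperbolic space) whose boundary
has sectional curvatures bounded below and passes through the given point. -/
def CondCurvBound (d : ℕ) (K : Set X) : Prop :=
  ∀ x ∈ frontier K, ∃ ε > 0, ∃ B : Set X,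
    {y | y ∈ K ∧ dist y x ≤ ε} ⊆ B ∧ x ∈ frontier B ∧
    (IsSphereSpace X d → ∃ (q : X) (R : ℝ), 0 < R ∧ R < Real.pi / 2 ∧
        ε ≤ Real.cos R / Real.sin R ∧ B = closedBall q R) ∧
    (IsEuclideanSpaceForm X d → ∃ (q : X) (R : ℝ), 0 < R ∧ ε ≤ 1 / R ∧ B = closedBall q R) ∧
    (IsHyperbolicSpace X d → ∃ (P : Set X) (lam : ℝ), IsHalfspace P ∧ 0 < lam ∧
        ε ≤ Real.tanh lam ∧ B = {y | infDist y P ≤ lam})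

/-- `K` has a supporting sphere at each of its boundary points
(for the sphere, of radius less than `π/2`). -/
def SupportingSpheres (d : ℕ) (K : Set X) : Prop :=
  ∀ x ∈ frontier K, ∃ (p : X) (R : ℝ), 0 < R ∧ K ⊆ closedBall p R ∧ x ∈ sphere p R ∧
    (IsSphereSpace X d → R < Real.pi / 2)

/-- `K` is `C¹` (smooth): at each boundary point there is a unique supporting half-space. -/
def SmoothBody (K : Set X) : Prop :=
  ∀ x ∈ frontier K, ∃! P : Set X, IsHalfspace P ∧ K ⊆ P ∧ x ∈ frontier P

/-- A complete geodesic (straight line). -/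
def IsGeodesicLine (B : Set X) : Prop := ∃ γ : ℝ → X, Isometry γ ∧ B = Set.range γ

/-- A circle (closed disc) of positive radius. -/
def IsDisc (K : Set X) : Prop := ∃ (p : X) (r : ℝ), 0 < r ∧ K = closedBall p r

/-- The parallel domain of `B` at distance `l`. -/
def parallelDomain (B : Set X) (l : ℝ) : Set X := {x | infDist x B ≤ l}

/-- `K` is the parallel domain of some straight line, at some distance `l > 0`. -/
def IsParallelDomain (K : Set X) : Prop :=
  ∃ (B : Set X) (l : ℝ), IsGeodesicLine B ∧ 0 < l ∧ K = parallelDomain B l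

/-- A convex domain bounded by a (proper) hypercycle. -/
def IsHypercycleDomain (K : Set X) : Prop :=
  ∃ (P : Set X) (l : ℝ), IsHalfspace P ∧ 0 < l ∧ K = {x | infDist x P ≤ l}

/-- `C` is a hypercycle or a straight line (a curve at constant distance `l ≥ 0`
from its base line). -/
def IsHypercycleOrLine (C : Set X) : Prop :=
  ∃ (P : Set X) (l : ℝ), IsHalfspace P ∧ 0 ≤ l ∧ C = frontier {x | infDist x P ≤ l}

/-- `C` is a hypercycle (or straight line) with base line `B`. -/
def HypercycleWithBase (C B : Set X) : Prop :=
  ∃ (P : Set X) (l : ℝ), IsHalfspace P ∧ 0 ≤ l ∧ frontier P = B ∧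
    C = frontier {x | infDist x P ≤ l}


/-! Cases (A)-(E) of Theorem 5 (hyperbolic plane). -/

/-- One of the basic bodies of case (A). -/
def CaseABody (K : Set X) : Prop :=
  IsDisc K ∨ IsParaball K ∨ IsHypercycleDomain K ∨ IsHalfspace K

/-- Case (A) of Theorem 5. -/
def CaseA (K L : Set X) : Prop :=
  CaseABody K ∧ CaseABody L ∧
    ((IsHypercycleDomain K ∨ IsHalfspace K) → IsDisc L ∨ Congruent K L) ∧
    ((IsHypercycleDomain L ∨ IsHalfspace L) → IsDisc K ∨ Congruent L K)

/-- `M` is bounded either by two hypercycles whose base lines coincide, or by a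
hypercycle and its base line. -/
def TwoHypSameBase (M : Set X) : Prop :=
  ∃ (B C₁ C₂ : Set X), IsGeodesicLine B ∧ C₁ ≠ C₂ ∧
    HypercycleWithBase C₁ B ∧ HypercycleWithBase C₂ B ∧ frontier M = C₁ ∪ C₂

/-- Case (B) of Theorem 5. -/
def CaseB (K L : Set X) : Prop :=
  (IsDisc K ∧ TwoHypSameBase L) ∨ (IsDisc L ∧ TwoHypSameBase K)

/-- `M` is bounded by at least two hypercycles or straight lines, with all base lines
different, whose mutual distances are at least `2r`. -/
def MultiHypFarApart (M : Set X) (r : ℝ) : Prop :=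
  (∀ x ∈ frontier M, IsHypercycleOrLine (connectedComponentIn (frontier M) x)) ∧
  (∃ x ∈ frontier M, ∃ y ∈ frontier M,
      connectedComponentIn (frontier M) x ≠ connectedComponentIn (frontier M) y) ∧
  (∀ x ∈ frontier M, ∀ y ∈ frontier M,
      connectedComponentIn (frontier M) x ≠ connectedComponentIn (frontier M) y →
        2 * r ≤ dist x y ∧
        ∀ B₁ B₂ : Set X, HypercycleWithBase (connectedComponentIn (frontier M) x) B₁ →
          HypercycleWithBase (connectedComponentIn (frontier M) y) B₂ → B₁ ≠ B₂)

/-- Case (C) of Theorem 5. -/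
def CaseC (K L : Set X) : Prop :=
  (∃ (p : X) (r : ℝ), 0 < r ∧ K = closedBall p r ∧ MultiHypFarApart L r) ∨
  (∃ (p : X) (r : ℝ), 0 < r ∧ L = closedBall p r ∧ MultiHypFarApart K r)

/-- Case (D) of Theorem 5. -/
def CaseD (K L : Set X) : Prop :=
  (IsParaball K ∧ IsParallelDomain L) ∨ (IsParaball L ∧ IsParallelDomain K)

/-- Case (E) of Theorem 5. -/
def CaseE (K L : Set X) : Prop :=
  Congruent K L ∧ IsParallelDomain K ∧ IsParallelDomain L

/-- All cases of (3) of Theorem 5 together. -/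
def Theorem5Cases (K L : Set X) : Prop :=
  CaseA K L ∨ CaseB K L ∨ CaseC K L ∨ CaseD K L ∨ CaseE K L

/-- Condition (1) of Theorem 5: every intersection of congruent copies admits some
non-trivial congruence. -/
def T5Cond1 (K L : Set X) : Prop :=
  ∀ φ ψ : X ≃ᵢ X, OrientationPreserving φ → OrientationPreserving ψ →
    (interior ((⇑φ '' K) ∩ (⇑ψ '' L))).Nonempty →
    AdmitsNontrivialCongruence ((⇑φ '' K) ∩ (⇑ψ '' L))

/-- Condition (2) of Theorem 5: every intersection of congruent copies is axially
symmetric. -/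
def T5Cond2 (K L : Set X) : Prop :=
  ∀ φ ψ : X ≃ᵢ X, OrientationPreserving φ → OrientationPreserving ψ →
    (interior ((⇑φ '' K) ∩ (⇑ψ '' L))).Nonempty →
    AxiallySymmetric ((⇑φ '' K) ∩ (⇑ψ '' L))

/-- All connected components of the boundary of `K` are hypercycles or straight lines. -/
def BdryHypOrLine (K : Set X) : Prop :=
  ∀ x ∈ frontier K, IsHypercycleOrLine (connectedComponentIn (frontier K) x)

/-- The boundary of `K` has at least two connected components. -/
def AtLeastTwoComponents (K : Set X) : Prop :=
  ∃ x ∈ frontier K, ∃ y ∈ frontier K,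
    connectedComponentIn (frontier K) x ≠ connectedComponentIn (frontier K) y

/-- The boundary of `K` is nonempty and has a single connected component. -/
def SingleComponent (K : Set X) : Prop :=
  (frontier K).Nonempty ∧ ∀ x ∈ frontier K, ∀ y ∈ frontier K,
    connectedComponentIn (frontier K) x = connectedComponentIn (frontier K) y

/-- The associated graph of `K` contains two edges with at least one common endpoint:
`K` has two distinct boundary components which are asymptotic (come arbitrarily close). -/
def TwoAsymptoticComponents (K : Set X) : Prop :=
  ∃ x ∈ frontier K, ∃ y ∈ frontier K,
    connectedComponentIn (frontier K) x ≠ connectedComponentIn (frontier K) y ∧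
    ∀ δ > (0 : ℝ), ∃ p ∈ connectedComponentIn (frontier K) x,
      ∃ q ∈ connectedComponentIn (frontier K) y, dist p q < δ

/-- The associated graph of `K` has only pairwise vertex-disjoint edges: distinct
boundary components of `K` stay at positive distance from each other. -/
def VertexDisjointEdges (K : Set X) : Prop :=
  ∀ x ∈ frontier K, ∀ y ∈ frontier K,
    connectedComponentIn (frontier K) x ≠ connectedComponentIn (frontier K) y →
      ∃ δ > (0 : ℝ), ∀ p ∈ connectedComponentIn (frontier K) x,
        ∀ q ∈ connectedComponentIn (frontier K) y, δ ≤ dist p q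

/-! Conditions of Theorem 6. -/

/-- Condition (1) of Theorem 6. -/
def T6Cond1 (K L : Set X) : Prop :=
  ∃ ε > (0 : ℝ), ∀ φ ψ : X ≃ᵢ X, OrientationPreserving φ → OrientationPreserving ψ →
    (interior ((⇑φ '' K) ∩ (⇑ψ '' L))).Nonempty →
    diam ((⇑φ '' K) ∩ (⇑ψ '' L)) < ε →
    CentrallySymmetric ((⇑φ '' K) ∩ (⇑ψ '' L))

/-- Condition (2) of Theorem 6. -/
def T6Cond2 (K L : Set X) : Prop :=
  ∀ x ∈ frontier K, ∀ y ∈ frontier L, ∃ ε > (0 : ℝ),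
    ∀ φ ψ : X ≃ᵢ X, OrientationPreserving φ → OrientationPreserving ψ →
      (interior ((⇑φ '' K) ∩ (⇑ψ '' L))).Nonempty →
      diam ((⇑φ '' K) ∩ (⇑ψ '' L)) < ε →
      ∀ (p : X) (r : ℝ), HasUniqueInball ((⇑φ '' K) ∩ (⇑ψ '' L)) p r →
        frontier ((⇑φ '' K) ∩ (⇑ψ '' L)) ∩ sphere p r = {φ x, ψ y} →
        φ x ∈ interior (⇑ψ '' L) → ψ y ∈ interior (⇑φ '' K) →
        IsMidpoint p (φ x) (ψ y) →
        CentrallySymmetric ((⇑φ '' K) ∩ (⇑ψ '' L))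

/-- Condition (3) of Theorem 6. -/
def T6Cond3 (K L : Set X) : Prop :=
  ∀ x ∈ frontier K, ∀ y ∈ frontier L, ∃ ε > (0 : ℝ),
    ∀ φ ψ : X ≃ᵢ X, OrientationPreserving φ → OrientationPreserving ψ →
      (interior ((⇑φ '' K) ∩ (⇑ψ '' L))).Nonempty →
      diam ((⇑φ '' K) ∩ (⇑ψ '' L)) < ε →
      ∀ (p : X) (r : ℝ), HasUniqueInball ((⇑φ '' K) ∩ (⇑ψ '' L)) p r →
        frontier ((⇑φ '' K) ∩ (⇑ψ '' L)) ∩ sphere p r = {φ x, ψ y} →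
        φ x ∈ interior (⇑ψ '' L) → ψ y ∈ interior (⇑φ '' K) →
        IsMidpoint p (φ x) (ψ y) →
        SymmetricWrtPerpBisector ((⇑φ '' K) ∩ (⇑ψ '' L)) (φ x) (ψ y)

/-- Condition (4) of Theorem 6. -/
def T6Cond4 (d : ℕ) (K L : Set X) : Prop :=
  (∃ r > (0 : ℝ), (IsSphereSpace X d → r ≤ Real.pi / 2) ∧
      (∀ C ∈ bdryComponents K ∪ bdryComponents L, ∃ p : X, C = sphere p r) ∧
      (∃ p : X, K = closedBall p r) ∧ ∃ q : X, L = closedBall q r) ∨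
  ((∀ C ∈ bdryComponents K ∪ bdryComponents L, IsParasphere C) ∧
      IsParaball K ∧ IsParaball L) ∨
  (∃ lam > (0 : ℝ), ∀ C ∈ bdryComponents K ∪ bdryComponents L, IsHypersphere C lam)

/-! Conditions of Theorems 7 and 8. -/

/-- The pair `φ, ψ` is admissible for hypothesis (****): both are orientation
preserving, and for the sphere `(φ K) ∪ (ψ L)` lies in an open hemisphere. -/
def GoodPair (d : ℕ) (K L : Set X) (φ ψ : X ≃ᵢ X) : Prop :=
  OrientationPreserving φ ∧ OrientationPreserving ψ ∧
    (IsSphereSpace X d → ∃ s : X, (⇑φ '' K) ∪ (⇑ψ '' L) ⊆ ball s (Real.pi / 2))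

/-- The convex hull of the union of the two congruent copies. -/
def hullUnion (K L : Set X) (φ ψ : X ≃ᵢ X) : Set X := gconvexHull ((⇑φ '' K) ∪ (⇑ψ '' L))

/-- Condition (A) of (3) of Theorem 7: the diameter of `M` is sufficiently close to `π`
(sphere), resp. sufficiently large (Euclidean, hyperbolic), as measured by `δ`. -/
def BigDiam (d : ℕ) (X : Type*) [MetricSpace X] (M : Set X) (δ : ℝ) : Prop :=
  (IsSphereSpace X d → Real.pi - δ < diam M) ∧ (¬ IsSphereSpace X d → 1 / δ < diam M)

/-- Condition (1) of Theorem 7. -/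
def T7Cond1 (d : ℕ) (K L : Set X) : Prop :=
  ∀ φ ψ : X ≃ᵢ X, GoodPair d K L φ ψ → CentrallySymmetric (hullUnion K L φ ψ)

/-- Condition (2) of Theorem 7. -/
def T7Cond2 (d : ℕ) (K L : Set X) : Prop :=
  ∀ φ ψ : X ≃ᵢ X, GoodPair d K L φ ψ → ∀ a b : X, UniqueDiametral (hullUnion K L φ ψ) a b →
    SymmetricWrtPerpBisector (hullUnion K L φ ψ) a b

/-- Condition (3) of Theorem 7. -/
def T7Cond3 (d : ℕ) (K L : Set X) : Prop :=
  ∃ δ > (0 : ℝ), ∀ φ ψ : X ≃ᵢ X, GoodPair d K L φ ψ →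
    ∀ x ∈ frontier K, ∀ y ∈ frontier L,
      BigDiam d X (hullUnion K L φ ψ) δ →
      UniqueDiametral (hullUnion K L φ ψ) (φ x) (ψ y) →
      CentrallySymmetric (hullUnion K L φ ψ)

/-- Condition (4) of Theorem 7. -/
def T7Cond4 (d : ℕ) (K L : Set X) : Prop :=
  ∃ δ > (0 : ℝ), ∀ φ ψ : X ≃ᵢ X, GoodPair d K L φ ψ →
    ∀ x ∈ frontier K, ∀ y ∈ frontier L,
      BigDiam d X (hullUnion K L φ ψ) δ →
      UniqueDiametral (hullUnion K L φ ψ) (φ x) (ψ y) →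
      SymmetricWrtPerpBisector (hullUnion K L φ ψ) (φ x) (ψ y)

/-- Condition (5) of Theorem 7. -/
def T7Cond5 (d : ℕ) (K L : Set X) : Prop :=
  ∃ δ > (0 : ℝ), ∀ φ ψ : X ≃ᵢ X, GoodPair d K L φ ψ →
    ∀ x ∈ frontier K, ∀ y ∈ frontier L,
      BigDiam d X (hullUnion K L φ ψ) δ →
      UniqueDiametral (hullUnion K L φ ψ) (φ x) (ψ y) →
      ∃ ε₀ > (0 : ℝ), ∀ ε : ℝ, 0 < ε → ε < ε₀ →
        (IsSphereSpace X d → ∃ s : X, (⇑φ '' K) ∪ (⇑ψ '' L) ⊆ ball s (Real.pi / 2) ∧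
            segCyl (φ x) (ψ y) ε ⊆ ball s (Real.pi / 2)) ∧
        CentrallySymmetric (hullUnion K L φ ψ ∩ segCyl (φ x) (ψ y) ε)

/-- Condition (6) of Theorem 7. -/
def T7Cond6 (d : ℕ) (K L : Set X) : Prop :=
  ∃ δ > (0 : ℝ), ∀ φ ψ : X ≃ᵢ X, GoodPair d K L φ ψ →
    ∀ x ∈ frontier K, ∀ y ∈ frontier L,
      BigDiam d X (hullUnion K L φ ψ) δ →
      UniqueDiametral (hullUnion K L φ ψ) (φ x) (ψ y) →
      ∃ ε₀ > (0 : ℝ), ∀ ε : ℝ, 0 < ε → ε < ε₀ →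
        (IsSphereSpace X d → ∃ s : X, (⇑φ '' K) ∪ (⇑ψ '' L) ⊆ ball s (Real.pi / 2) ∧
            segCyl (φ x) (ψ y) ε ⊆ ball s (Real.pi / 2)) ∧
        SymmetricWrtPerpBisector (hullUnion K L φ ψ ∩ segCyl (φ x) (ψ y) ε) (φ x) (ψ y)

/-- Condition (7) of Theorem 7: `K` and `L` are congruent balls. -/
def T7Cond7 (d : ℕ) (K L : Set X) : Prop :=
  ∃ r > (0 : ℝ), (IsSphereSpace X d → r < Real.pi / 2) ∧
    (∃ p : X, K = closedBall p r) ∧ ∃ q : X, L = closedBall q r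

/-- Condition (1) of Theorem 8. -/
def T8Cond1 (K L : Set X) : Prop :=
  ∀ φ ψ : X ≃ᵢ X, GoodPair 2 K L φ ψ → AxiallySymmetric (hullUnion K L φ ψ)

/-- Condition (2) of Theorem 8. -/
def T8Cond2 (K L : Set X) : Prop :=
  ∀ φ ψ : X ≃ᵢ X, GoodPair 2 K L φ ψ → AdmitsNontrivialCongruence (hullUnion K L φ ψ)

/-- Condition (3) of Theorem 8. -/
def T8Cond3 (K L : Set X) : Prop :=
  ∃ δ > (0 : ℝ), ∀ φ ψ : X ≃ᵢ X, GoodPair 2 K L φ ψ →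
    ∀ x ∈ frontier K, ∀ y ∈ frontier L,
      BigDiam 2 X (hullUnion K L φ ψ) δ →
      UniqueDiametral (hullUnion K L φ ψ) (φ x) (ψ y) →
      AxiallySymmetric (hullUnion K L φ ψ)

/-- Condition (4) of Theorem 8. -/
def T8Cond4 (K L : Set X) : Prop :=
  ∃ δ > (0 : ℝ), ∀ φ ψ : X ≃ᵢ X, GoodPair 2 K L φ ψ →
    ∀ x ∈ frontier K, ∀ y ∈ frontier L,
      BigDiam 2 X (hullUnion K L φ ψ) δ →
      UniqueDiametral (hullUnion K L φ ψ) (φ x) (ψ y) →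
      AdmitsNontrivialCongruence (hullUnion K L φ ψ)

/-- Condition (5) of Theorem 8. -/
def T8Cond5 (K L : Set X) : Prop :=
  ∃ δ > (0 : ℝ), ∀ φ ψ : X ≃ᵢ X, GoodPair 2 K L φ ψ →
    ∀ x ∈ frontier K, ∀ y ∈ frontier L,
      BigDiam 2 X (hullUnion K L φ ψ) δ →
      UniqueDiametral (hullUnion K L φ ψ) (φ x) (ψ y) →
      ∃ ε₀ > (0 : ℝ), ∀ ε : ℝ, 0 < ε → ε < ε₀ →
        (IsSphereSpace X 2 → ∃ s : X, (⇑φ '' K) ∪ (⇑ψ '' L) ⊆ ball s (Real.pi / 2) ∧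
            segCyl (φ x) (ψ y) ε ⊆ ball s (Real.pi / 2)) ∧
        AxiallySymmetric (hullUnion K L φ ψ ∩ segCyl (φ x) (ψ y) ε)

/-- Condition (6) of Theorem 8. -/
def T8Cond6 (K L : Set X) : Prop :=
  ∃ δ > (0 : ℝ), ∀ φ ψ : X ≃ᵢ X, GoodPair 2 K L φ ψ →
    ∀ x ∈ frontier K, ∀ y ∈ frontier L,
      BigDiam 2 X (hullUnion K L φ ψ) δ →
      UniqueDiametral (hullUnion K L φ ψ) (φ x) (ψ y) →
      ∃ ε₀ > (0 : ℝ), ∀ ε : ℝ, 0 < ε → ε < ε₀ →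
        (IsSphereSpace X 2 → ∃ s : X, (⇑φ '' K) ∪ (⇑ψ '' L) ⊆ ball s (Real.pi / 2) ∧
            segCyl (φ x) (ψ y) ε ⊆ ball s (Real.pi / 2)) ∧
        AdmitsNontrivialCongruence (hullUnion K L φ ψ ∩ segCyl (φ x) (ψ y) ε)

/-- Condition (7) of Theorem 8: `K` and `L` are (in general incongruent) circles. -/
def T8Cond7 (K L : Set X) : Prop :=
  ∃ (p q : X) (r s : ℝ), 0 < r ∧ 0 < s ∧
    (IsSphereSpace X 2 → r < Real.pi / 2 ∧ s < Real.pi / 2) ∧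
    K = closedBall p r ∧ L = closedBall q s


/-- The signed distance of a point from the boundary line of the half-plane `P`
(positive outside `P`, negative in the interior of `P`). -/
noncomputable def sdist (P : Set X) (x : X) : ℝ :=
  infDist x P - infDist x (closure Pᶜ)

/-- Weierstrass coordinates on the hyperbolic plane: `(t, y, z)` identifies `X` with the sheet
`t ^ 2 = 1 + y ^ 2 + z ^ 2`, `0 < t`, of the hyperboloid. -/
structure HypChart (X : Type*) [MetricSpace X] where
  t : X → ℝ
  y : X → ℝ
  z : X → ℝ
  t_pos : ∀ x, 0 < t x
  t_sq : ∀ x, t x ^ 2 = 1 + y x ^ 2 + z x ^ 2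
  cosh_dist : ∀ p q, Real.cosh (dist p q) = t p * t q - y p * y q - z p * z q
  surj : ∀ a b, ∃ x, y x = a ∧ z x = b

theorem IsHyperbolicSpace.nonempty_hypChart (hX : IsHyperbolicSpace X 2) :
    Nonempty (HypChart X) := by
  obtain ⟨e, -, hr, hd⟩ := hX
  have hmem : ∀ x, mink 2 (e x) (e x) = -1 ∧ 0 < (e x).2 := fun x => by
    have : e x ∈ Set.range e := ⟨x, rfl⟩
    rwa [hr] at this
  refine ⟨⟨fun x => (e x).2, fun x => (e x).1 0, fun x => (e x).1 1, fun x => (hmem x).2,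
    fun x => ?_, fun p q => ?_, fun a b => ?_⟩⟩
  · have := (hmem x).1
    simp only [mink, PiLp.inner_apply, Fin.sum_univ_two, RCLike.inner_apply, conj_trivial] at this
    linarith
  · rw [hd]
    simp only [mink, PiLp.inner_apply, Fin.sum_univ_two, RCLike.inner_apply, conj_trivial]
    ring
  · have h0 : (0 : ℝ) < 1 + a ^ 2 + b ^ 2 := by positivity
    have : ((!₂[a, b], √(1 + a ^ 2 + b ^ 2)) : EuclideanSpace ℝ (Fin 2) × ℝ) ∈ Set.range e := by
      rw [hr]
      refine ⟨?_, Real.sqrt_pos.2 h0⟩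
      simp only [mink, PiLp.inner_apply, Fin.sum_univ_two, RCLike.inner_apply, conj_trivial]
      rw [Real.mul_self_sqrt h0.le]
      simp
      ring
    obtain ⟨x, hx⟩ := this
    exact ⟨x, by simp [hx], by simp [hx]⟩

namespace HypChart

variable (φ : HypChart X)

theorem t_eq_of_sq {x : X} {a : ℝ} (ha : 0 ≤ a) (h : a ^ 2 = 1 + φ.y x ^ 2 + φ.z x ^ 2) :
    φ.t x = a :=
  (pow_left_inj₀ (φ.t_pos x).le ha two_ne_zero).1 (by rw [φ.t_sq, h])

theorem ext_yz {p q : X} (hy : φ.y p = φ.y q) (hz : φ.z p = φ.z q) : p = q := by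
  have ht : φ.t p = φ.t q := φ.t_eq_of_sq (φ.t_pos q).le (by rw [φ.t_sq, hy, hz])
  have h := φ.cosh_dist p q
  rw [ht, hy, hz, show φ.t q * φ.t q - φ.y q * φ.y q - φ.z q * φ.z q = 1 by
    linarith [φ.t_sq q], ← Real.cosh_zero] at h
  exact dist_eq_zero.1 (Real.cosh_injOn (mem_Ici.2 dist_nonneg) (mem_Ici.2 le_rfl) h)

theorem abs_y_lt_t (x : X) : |φ.y x| < φ.t x :=
  abs_lt_of_sq_lt_sq (by nlinarith [φ.t_sq x, sq_nonneg (φ.z x)]) (φ.t_pos x).le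

/-- Rotation of a chart about its origin. -/
def rotate (C S : ℝ) (h : C ^ 2 + S ^ 2 = 1) : HypChart X where
  t := φ.t
  y := fun x => C * φ.y x + S * φ.z x
  z := fun x => -S * φ.y x + C * φ.z x
  t_pos := φ.t_pos
  t_sq := fun x => by linear_combination φ.t_sq x - (φ.y x ^ 2 + φ.z x ^ 2) * h
  cosh_dist := fun p q => by
    linear_combination φ.cosh_dist p q + (φ.y p * φ.y q + φ.z p * φ.z q) * h
  surj := fun a b => by
    obtain ⟨x, hy, hz⟩ := φ.surj (C * a - S * b) (S * a + C * b)
    refine ⟨x, ?_, ?_⟩ <;> rw [hy, hz]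
    · linear_combination a * h
    · linear_combination b * h

/-- Hyperbolic translation of a chart along the line `z = 0`. -/
def boost (C S : ℝ) (h : C ^ 2 - S ^ 2 = 1) (hC : 0 < C) : HypChart X where
  t := fun x => C * φ.t x + S * φ.y x
  y := fun x => S * φ.t x + C * φ.y x
  z := φ.z
  t_pos := fun x => by
    have h1 : |S| < C := abs_lt_of_sq_lt_sq (by linarith) hC.le
    have h3 : |S * φ.y x| < C * φ.t x := by
      rw [abs_mul]
      exact mul_lt_mul'' h1 (φ.abs_y_lt_t x) (abs_nonneg _) (abs_nonneg _)
    linarith [neg_abs_le (S * φ.y x)]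
  t_sq := fun x => by linear_combination φ.t_sq x + (φ.t x ^ 2 - φ.y x ^ 2) * h
  cosh_dist := fun p q => by
    linear_combination φ.cosh_dist p q - (φ.t p * φ.t q - φ.y p * φ.y q) * h
  surj := fun a b => by
    set T := √(1 + a ^ 2 + b ^ 2) with hT
    have hT2 : T ^ 2 = 1 + a ^ 2 + b ^ 2 := Real.sq_sqrt (by positivity)
    have hT0 : 0 < T := Real.sqrt_pos.2 (by positivity)
    obtain ⟨x, hy, hz⟩ := φ.surj (C * a - S * T) b
    have h1 : |S| < C := abs_lt_of_sq_lt_sq (by linarith) hC.le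
    have h2 : |a| < T := abs_lt_of_sq_lt_sq (by nlinarith [sq_nonneg b]) hT0.le
    have h3 : |S * a| < C * T := by
      rw [abs_mul]
      exact mul_lt_mul'' h1 h2 (abs_nonneg _) (abs_nonneg _)
    have ht : φ.t x = C * T - S * a := by
      refine φ.t_eq_of_sq (by linarith [le_abs_self (S * a)]) ?_
      rw [hy, hz]
      linear_combination (T ^ 2 - a ^ 2) * h + hT2
    refine ⟨x, ?_, hz⟩
    rw [ht, hy]
    linear_combination a * h

theorem exists_rotate_z_eq_zero (a : X) :
    ∃ (C S : ℝ) (h : C ^ 2 + S ^ 2 = 1), (φ.rotate C S h).z a = 0 := by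
  by_cases h0 : φ.y a ^ 2 + φ.z a ^ 2 = 0
  · refine ⟨1, 0, by norm_num, ?_⟩
    have : φ.z a = 0 := by nlinarith [sq_nonneg (φ.y a), sq_nonneg (φ.z a)]
    simp [rotate, this]
  · have hp : 0 < φ.y a ^ 2 + φ.z a ^ 2 := lt_of_le_of_ne (by positivity) (Ne.symm h0)
    have hs := Real.sq_sqrt hp.le
    have hs0 := Real.sqrt_pos.2 hp
    refine ⟨φ.y a / √(φ.y a ^ 2 + φ.z a ^ 2), φ.z a / √(φ.y a ^ 2 + φ.z a ^ 2), ?_, ?_⟩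
    · rw [div_pow, div_pow, hs]
      field_simp
    · simp only [rotate]
      ring

/-- Translating along `z = 0` moves any point onto the line `y = 0`. -/
theorem exists_y_eq_zero (o : X) : ∃ ψ : HypChart X, ψ.y o = 0 ∧ ψ.z = φ.z := by
  have hp : 0 < 1 + φ.z o ^ 2 := by positivity
  have hs := Real.sq_sqrt hp.le
  have hs0 := Real.sqrt_pos.2 hp
  refine ⟨φ.boost (φ.t o / √(1 + φ.z o ^ 2)) (-φ.y o / √(1 + φ.z o ^ 2)) ?_
    (div_pos (φ.t_pos o) hs0), ?_, rfl⟩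
  · rw [div_pow, div_pow, hs, φ.t_sq]
    field_simp
    ring
  · simp only [boost]
    ring

/-- Any two points can be placed symmetrically with respect to the line `z = 0`. -/
theorem exists_symmetric (φ : HypChart X) (a b : X) :
    ∃ ψ : HypChart X, ψ.y a = 0 ∧ ψ.y b = 0 ∧ ψ.z a = -ψ.z b := by
  obtain ⟨C, S, h, hz⟩ := φ.exists_rotate_z_eq_zero a
  obtain ⟨φ₁, hya, hz₁⟩ := exists_y_eq_zero (φ.rotate C S h) a
  obtain ⟨C', S', h', hzb⟩ := φ₁.exists_rotate_z_eq_zero b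
  set φ₂ := φ₁.rotate C' S' h' with h₂
  have hza₁ : φ₁.z a = 0 := by rw [hz₁, hz]
  have hza : φ₂.z a = 0 := by simp [h₂, rotate, hza₁, hya]
  have hya₂ : φ₂.y a = 0 := by simp [h₂, rotate, hza₁, hya]
  have hta : φ₂.t a = 1 := φ₂.t_eq_of_sq zero_le_one (by rw [hza, hya₂]; norm_num)
  set s := Real.arsinh (φ₂.y b) with hs
  have hsy : Real.sinh s = φ₂.y b := Real.sinh_arsinh _
  have hst : φ₂.t b = Real.cosh s := φ₂.t_eq_of_sq (Real.cosh_pos _).le (by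
    rw [hzb, ← hsy, Real.cosh_sq]; ring)
  set φ₃ := φ₂.boost (Real.cosh (s / 2)) (-Real.sinh (s / 2))
    (by rw [Real.cosh_sq]; ring) (Real.cosh_pos _) with h₃
  refine ⟨φ₃.rotate 0 1 (by norm_num), ?_, ?_, ?_⟩
  · simp [h₃, rotate, boost, hza]
  · simp [h₃, rotate, boost, hzb]
  · have e1 : φ₂.y b = 2 * Real.sinh (s / 2) * Real.cosh (s / 2) := by
      rw [← hsy, ← Real.sinh_two_mul]; ring_nf
    have e2 : φ₂.t b = Real.cosh (s / 2) ^ 2 + Real.sinh (s / 2) ^ 2 := by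
      rw [hst, ← Real.cosh_two_mul]; ring_nf
    simp only [h₃, rotate, boost, hzb, hza, hta, hya₂, e1, e2]
    have := Real.cosh_sq (s / 2)
    linear_combination -Real.sinh (s / 2) * this

/-- The point with given coordinates. -/
noncomputable def pt (p : ℝ × ℝ) : X := (φ.surj p.1 p.2).choose

@[simp] theorem y_pt (p : ℝ × ℝ) : φ.y (φ.pt p) = p.1 := (φ.surj p.1 p.2).choose_spec.1

@[simp] theorem z_pt (p : ℝ × ℝ) : φ.z (φ.pt p) = p.2 := (φ.surj p.1 p.2).choose_spec.2

theorem pt_yz (x : X) : φ.pt (φ.y x, φ.z x) = x := φ.ext_yz (by simp) (by simp)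

theorem t_pt (p : ℝ × ℝ) : φ.t (φ.pt p) = √(1 + p.1 ^ 2 + p.2 ^ 2) :=
  φ.t_eq_of_sq (Real.sqrt_nonneg _) (by rw [Real.sq_sqrt (by positivity), y_pt, z_pt])

theorem continuous_pt : Continuous φ.pt := by
  refine continuous_iff_continuousAt.2 fun p => tendsto_iff_dist_tendsto_zero.2 ?_
  have h : ∀ q, dist (φ.pt q) (φ.pt p) =
      Real.arcosh (√(1 + q.1 ^ 2 + q.2 ^ 2) * √(1 + p.1 ^ 2 + p.2 ^ 2)
        - q.1 * p.1 - q.2 * p.2) := fun q => by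
    rw [← Real.arcosh_cosh (x := dist (φ.pt q) (φ.pt p)) dist_nonneg, φ.cosh_dist]
    simp [t_pt]
  have hc : Continuous fun q => dist (φ.pt q) (φ.pt p) := by
    simp_rw [h]
    refine Real.continuousOn_arcosh.comp_continuous (by fun_prop) fun q => ?_
    have := φ.cosh_dist (φ.pt q) (φ.pt p)
    simp only [t_pt, y_pt, z_pt] at this
    rw [mem_Ici, ← this]
    exact Real.one_le_cosh _
  simpa using hc.tendsto p

theorem isPreconnected_compl_singleton_origin : IsPreconnected {x | ¬(φ.y x = 0 ∧ φ.z x = 0)} := by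
  have h : {x | ¬(φ.y x = 0 ∧ φ.z x = 0)} = φ.pt '' {0}ᶜ := by
    ext x
    constructor
    · exact fun hx => ⟨(φ.y x, φ.z x), fun h0 => hx (by simpa using h0), φ.pt_yz x⟩
    · rintro ⟨p, hp, rfl⟩
      simpa [Prod.ext_iff] using hp
  rw [h]
  refine IsPreconnected.image (isConnected_compl_singleton_of_one_lt_rank ?_ 0).isPreconnected _
    φ.continuous_pt.continuousOn
  rw [rank_prod', Module.rank_self]
  norm_num

theorem isPreconnected_z_pos : IsPreconnected {x | 0 < φ.z x} := by
  have h : {x | 0 < φ.z x} = φ.pt '' (univ ×ˢ Ioi 0) := by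
    ext x
    constructor
    · exact fun hx => ⟨(φ.y x, φ.z x), ⟨mem_univ _, hx⟩, φ.pt_yz x⟩
    · rintro ⟨p, hp, rfl⟩
      simpa using hp
  rw [h]
  exact ((convex_univ.prod (convex_Ioi 0)).isPreconnected).image _ φ.continuous_pt.continuousOn

/-- The mirror of a reflection is the line `z = 0` in a suitable chart, and the reflection
interchanges the sides of this line. -/
theorem exists_mirror (φ : HypChart X) {σ : X ≃ᵢ X} (hσ : IsReflection σ) :
    ∃ ψ : HypChart X, {x | σ x = x} = {x | ψ.z x = 0} ∧ ∀ x, ψ.z (σ x) = -ψ.z x := by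
  obtain ⟨hinv, hne, hdis⟩ := hσ
  have hinv' : ∀ x, σ (σ x) = x := fun x =>
    congrArg (fun f : X ≃ᵢ X => f x) hinv
  obtain ⟨a, ha⟩ : ∃ a, σ a ≠ a := by
    by_contra! h
    exact hne (IsometryEquiv.ext h)
  obtain ⟨ψ, hya, hyb, hzab⟩ := φ.exists_symmetric a (σ a)
  have hz0 : ψ.z a ≠ 0 := fun h => ha (ψ.ext_yz (by rw [hya, hyb]) (by linarith))
  have hzb : ψ.z (σ a) = -ψ.z a := by linarith
  have htab : ψ.t (σ a) = ψ.t a :=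
    ψ.t_eq_of_sq (ψ.t_pos a).le (by rw [ψ.t_sq, hya, hyb, hzb]; ring)
  have h1 : ∀ x, ψ.t (σ x) * ψ.t a - ψ.z (σ x) * ψ.z a = ψ.t x * ψ.t a + ψ.z x * ψ.z a := by
    intro x
    have e1 := ψ.cosh_dist (σ x) (σ (σ a))
    rw [σ.isometry.dist_eq, ψ.cosh_dist, hinv', htab, hya, hyb, hzb] at e1
    linarith
  have h2 : ∀ x, ψ.t (σ x) * ψ.t a + ψ.z (σ x) * ψ.z a = ψ.t x * ψ.t a - ψ.z x * ψ.z a := by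
    intro x
    have e1 := ψ.cosh_dist (σ x) (σ a)
    rw [σ.isometry.dist_eq, ψ.cosh_dist, htab, hya, hyb, hzb] at e1
    linarith
  have ht : ∀ x, ψ.t (σ x) = ψ.t x := fun x =>
    mul_right_cancel₀ (ψ.t_pos a).ne' (by linarith [h1 x, h2 x])
  have hz : ∀ x, ψ.z (σ x) = -ψ.z x := fun x =>
    mul_right_cancel₀ hz0 (by linarith [h1 x, h2 x])
  have hy : ∀ x x', ψ.y (σ x) * ψ.y (σ x') = ψ.y x * ψ.y x' := by
    intro x x'
    have e1 := ψ.cosh_dist (σ x) (σ x')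
    rw [σ.isometry.dist_eq, ψ.cosh_dist, ht, ht, hz, hz] at e1
    linarith
  refine ⟨ψ, ?_, hz⟩
  have hsub : ∀ x, σ x = x → ψ.z x = 0 := fun x hx => by
    have := hz x
    rw [hx] at this
    linarith
  by_cases hall : ∀ x, ψ.z x = 0 → σ x = x
  · ext x
    exact ⟨hsub x, hall x⟩
  · push Not at hall
    obtain ⟨x₀, hx₀, hx₀'⟩ := hall
    have hy₀ : ψ.y (σ x₀) ≠ ψ.y x₀ := fun h => hx₀' (ψ.ext_yz h (by rw [hz, hx₀, neg_zero]))
    have hy₁ : ψ.y (σ x₀) = -ψ.y x₀ :=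
      (mul_self_eq_mul_self_iff.1 (hy x₀ x₀)).resolve_left hy₀
    have hy₂ : ψ.y x₀ ≠ 0 := fun h => hy₀ (by rw [hy₁, h, neg_zero])
    have hyneg : ∀ x, ψ.y (σ x) = -ψ.y x := fun x => by
      have := hy x x₀
      rw [hy₁] at this
      exact mul_right_cancel₀ hy₂ (by linarith)
    refine absurd ?_ hdis
    convert ψ.isPreconnected_compl_singleton_origin using 3 with x
    rw [not_iff_not]
    constructor
    · intro hx
      have := hyneg x
      rw [hx] at this
      exact ⟨by linarith, hsub x hx⟩
    · rintro ⟨h3, h4⟩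
      exact ψ.ext_yz (by rw [hyneg, h3, neg_zero]) (by rw [hz, h4, neg_zero])

end HypChart

/-- A half-plane is `z ≤ 0` in a suitable chart. -/
theorem IsHalfspace.exists_hypChart (hX : IsHyperbolicSpace X 2) {P : Set X}
    (hP : IsHalfspace P) : ∃ φ : HypChart X, P = {x | φ.z x ≤ 0} := by
  obtain ⟨φ₀⟩ := hX.nonempty_hypChart
  obtain ⟨σ, hσ, hcl, hun, hint⟩ := hP
  obtain ⟨φ, hfix, hz⟩ := φ₀.exists_mirror hσ
  have hinv : ∀ x, σ (σ x) = x := fun x =>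
    congrArg (fun f : X ≃ᵢ X => f x) hσ.1
  have hmem : ∀ x, x ∈ ⇑σ '' P ↔ σ x ∈ P := fun x =>
    ⟨by rintro ⟨w, hw, rfl⟩; rwa [hinv], fun h => ⟨σ x, h, hinv x⟩⟩
  have hor : ∀ x, x ∈ P ∨ σ x ∈ P := fun x => by
    rw [← hmem, ← mem_union, hun]
    trivial
  have hand : ∀ x, x ∈ P ∧ σ x ∈ P ↔ φ.z x = 0 := fun x => by
    have : x ∈ P ∩ ⇑σ '' P ↔ x ∈ {x | φ.z x = 0} := by rw [hint, hfix]
    rwa [mem_inter_iff, hmem] at this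
  have hcl' : IsClosed (⇑σ '' P) := σ.toHomeomorph.isClosedMap _ hcl
  have hconn := isPreconnected_closed_iff.1 φ.isPreconnected_z_pos P (⇑σ '' P) hcl hcl'
    (by rw [hun]; exact subset_univ _)
  have hcase : (∀ x, 0 < φ.z x → x ∉ P) ∨ (∀ x, 0 < φ.z x → σ x ∉ P) := by
    by_contra! h
    obtain ⟨⟨p, hp, hpP⟩, q, hq, hqP⟩ := h
    obtain ⟨w, hw, hwP⟩ := hconn ⟨p, hp, hpP⟩ ⟨q, hq, (hmem q).2 hqP⟩
    have := (hand w).1 ⟨hwP.1, (hmem w).1 hwP.2⟩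
    exact absurd hw (by simp [this])
  rcases hcase with h | h
  · refine ⟨φ, Subset.antisymm (fun x hx => not_lt.1 fun h' => h x h' hx) fun x hx => ?_⟩
    rcases (show φ.z x ≤ 0 from hx).lt_or_eq with h' | h'
    · exact (hor x).resolve_right (h _ (by rw [hz]; linarith))
    · exact ((hand x).2 h').1
  · refine ⟨φ.rotate (-1) 0 (by norm_num), ?_⟩
    have : {x | (φ.rotate (-1) 0 (by norm_num)).z x ≤ 0} = {x | 0 ≤ φ.z x} := by
      ext x
      simp [HypChart.rotate]
    rw [this]
    refine Subset.antisymm (fun x hx => show 0 ≤ φ.z x from not_lt.1 fun h' => ?_) fun x hx => ?_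
    · exact h (σ x) (by rw [hz]; linarith) (by rwa [hinv])
    · rcases (show 0 ≤ φ.z x from hx).lt_or_eq with h' | h'
      · exact (hor x).resolve_right (h x h')
      · exact ((hand x).2 h'.symm).1

namespace HypChart

variable (φ : HypChart X)

theorem infDist_eq_arsinh {S : Set X} (hS : ∀ p ∈ S, φ.z p ≤ 0)
    (h0 : ∀ p, φ.z p = 0 → p ∈ closure S) {x : X} (hx : 0 ≤ φ.z x) :
    infDist x S = Real.arsinh (φ.z x) := by
  have hp : 0 < 1 + φ.z x ^ 2 := by positivity
  have hs := Real.sq_sqrt hp.le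
  have hs0 := Real.sqrt_pos.2 hp
  set w := √(1 + φ.z x ^ 2) with hw
  have har : 0 ≤ Real.arsinh (φ.z x) := Real.arsinh_nonneg_iff.2 hx
  have hne : S.Nonempty := closure_nonempty_iff.1 ⟨φ.pt (0, 0), h0 _ (by simp)⟩
  apply le_antisymm
  · set q := φ.pt (φ.y x / w, 0) with hq
    have hyq : φ.y q = φ.y x / w := by simp [hq]
    have hzq : φ.z q = 0 := by simp [hq]
    have htq : φ.t q = φ.t x / w := by
      refine φ.t_eq_of_sq (div_pos (φ.t_pos x) hs0).le ?_
      rw [hyq, hzq, div_pow, div_pow, hs, φ.t_sq]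
      field_simp
      ring
    have hd : dist x q = Real.arsinh (φ.z x) := by
      refine Real.cosh_injOn (mem_Ici.2 dist_nonneg) (mem_Ici.2 har) ?_
      rw [φ.cosh_dist, Real.cosh_arsinh, ← hw, hyq, hzq, htq]
      field_simp
      linarith [φ.t_sq x]
    rw [← hd, ← infDist_closure]
    exact infDist_le_dist_of_mem (h0 q hzq)
  · refine (le_infDist hne).2 fun p hpS => ?_
    rw [← abs_of_nonneg har, ← abs_of_nonneg (dist_nonneg (x := x) (y := p)), ← Real.cosh_le_cosh,
      Real.cosh_arsinh, φ.cosh_dist, ← hw]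
    have hyy : 0 < φ.t x * φ.t p - φ.y x * φ.y p := by
      have : |φ.y x * φ.y p| < φ.t x * φ.t p := by
        rw [abs_mul]
        exact mul_lt_mul'' (φ.abs_y_lt_t x) (φ.abs_y_lt_t p) (abs_nonneg _) (abs_nonneg _)
      linarith [le_abs_self (φ.y x * φ.y p)]
    have h1 : w ≤ φ.t x * φ.t p - φ.y x * φ.y p := by
      refine le_of_sq_le_sq ?_ hyy.le
      have e : (φ.t x * φ.t p - φ.y x * φ.y p) ^ 2 = (1 + φ.z x ^ 2) * (1 + φ.z p ^ 2)
          + (φ.t x * φ.y p - φ.t p * φ.y x) ^ 2 := by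
        linear_combination (φ.t p ^ 2 - φ.y p ^ 2) * φ.t_sq x + (1 + φ.z x ^ 2) * φ.t_sq p
      rw [e, hs]
      nlinarith [sq_nonneg (φ.t x * φ.y p - φ.t p * φ.y x), sq_nonneg (φ.z p)]
    nlinarith [mul_nonneg hx (neg_nonneg.2 (hS p hpS))]

theorem sdist_eq_arsinh (x : X) : sdist {x | φ.z x ≤ 0} x = Real.arsinh (φ.z x) := by
  set P := {x | φ.z x ≤ 0} with hP
  have hcl : ∀ p, φ.z p = 0 → p ∈ closure Pᶜ := fun p hp => by
    have h1 : (φ.y p, (0 : ℝ)) ∈ closure (univ ×ˢ Ioi (0 : ℝ)) := by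
      rw [closure_prod_eq, closure_Ioi]
      simp
    have h2 := image_closure_subset_closure_image φ.continuous_pt (mem_image_of_mem φ.pt h1)
    rw [← hp, φ.pt_yz] at h2
    refine closure_mono ?_ h2
    rintro _ ⟨q, hq, rfl⟩
    simpa [hP, hp] using hq
  rcases le_total 0 (φ.z x) with hx | hx
  · have hx' : x ∈ closure Pᶜ := by
      rcases hx.lt_or_eq with h | h
      · exact subset_closure (not_le.2 h)
      · exact hcl x h.symm
    rw [sdist, infDist_zero_of_mem hx', sub_zero]
    exact φ.infDist_eq_arsinh (fun p hp => hp) (fun p hp => subset_closure hp.le) hx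
  · have hx' : x ∈ P := hx
    rw [sdist, infDist_zero_of_mem hx', zero_sub, infDist_closure]
    set ψ := φ.rotate (-1) 0 (by norm_num) with hψ
    have hz : ∀ p, ψ.z p = -φ.z p := fun p => by simp [hψ, rotate]
    rw [ψ.infDist_eq_arsinh (S := Pᶜ) (x := x), hz, Real.arsinh_neg, neg_neg]
    · intro p hp
      rw [hz]
      exact neg_nonpos.2 (not_le.1 (show ¬ φ.z p ≤ 0 from hp)).le
    · exact fun p hp => hcl p (neg_eq_zero.1 (hz p ▸ hp))
    · rw [hz]
      exact neg_nonneg.2 hx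

/-- Parametrization by the central angle of the circle of radius `r` whose centre has coordinates
`y = 0`, `z = sinh c`; the angle is measured from the direction of the line `z = 0`. -/
noncomputable def circle (c r θ : ℝ) : X :=
  φ.pt (Real.sinh r * Real.sin θ,
    Real.cosh r * Real.sinh c - Real.sinh r * Real.cosh c * Real.cos θ)

theorem y_circle (c r θ : ℝ) : φ.y (φ.circle c r θ) = Real.sinh r * Real.sin θ := φ.y_pt _

theorem z_circle (c r θ : ℝ) : φ.z (φ.circle c r θ) =
    Real.cosh r * Real.sinh c - Real.sinh r * Real.cosh c * Real.cos θ := φ.z_pt _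

theorem t_circle (c r θ : ℝ) : φ.t (φ.circle c r θ) =
    Real.cosh r * Real.cosh c - Real.sinh r * Real.sinh c * Real.cos θ := by
  apply φ.t_eq_of_sq
  · have h1 := Real.cosh_pos (r + c)
    have h2 := Real.cosh_pos (r - c)
    rw [Real.cosh_add] at h1
    rw [Real.cosh_sub] at h2
    have h3 := Real.neg_one_le_cos θ
    have h4 := Real.cos_le_one θ
    nlinarith [mul_nonneg h1.le (sub_nonneg.2 h4),
      mul_nonneg h2.le (by linarith : 0 ≤ 1 + Real.cos θ)]
  · rw [y_circle, z_circle]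
    have e1 := Real.cosh_sq r
    have e2 := Real.cosh_sq c
    have e3 := Real.sin_sq_add_cos_sq θ
    linear_combination (Real.cosh r ^ 2 - Real.sinh r ^ 2 * Real.cos θ ^ 2) * e2 + e1
      - Real.sinh r ^ 2 * e3

theorem continuous_circle (c r : ℝ) : Continuous (φ.circle c r) :=
  φ.continuous_pt.comp (by fun_prop)

theorem sinh_half_dist_circle (c : ℝ) {r : ℝ} (hr : 0 ≤ r) (a b : ℝ) :
    Real.sinh (dist (φ.circle c r a) (φ.circle c r b) / 2) =
      Real.sinh r * |Real.sin ((a - b) / 2)| := by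
  set d := dist (φ.circle c r a) (φ.circle c r b) with hd
  have hd0 : 0 ≤ d := dist_nonneg
  refine (pow_left_inj₀ (Real.sinh_nonneg_iff.2 (by linarith))
    (mul_nonneg (Real.sinh_nonneg_iff.2 hr) (abs_nonneg _)) two_ne_zero).1 ?_
  rw [mul_pow, sq_abs]
  have h1 := φ.cosh_dist (φ.circle c r a) (φ.circle c r b)
  rw [← hd, t_circle, t_circle, y_circle, y_circle, z_circle, z_circle] at h1
  have h2 : Real.cosh d = Real.cosh (d / 2) ^ 2 + Real.sinh (d / 2) ^ 2 := by
    rw [← Real.cosh_two_mul]; ring_nf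
  have h3 : Real.cos (a - b) = 1 - 2 * Real.sin ((a - b) / 2) ^ 2 := by
    rw [← Real.cos_two_mul_eq_one_sub]; ring_nf
  have h4 := Real.cos_sub a b
  have e1 := Real.cosh_sq r
  have e2 := Real.cosh_sq c
  have e3 := Real.cosh_sq (d / 2)
  linear_combination (-h2 - e3 + h1 +
    (Real.cosh r ^ 2 - Real.sinh r ^ 2 * Real.cos a * Real.cos b) * e2
    + e1 + Real.sinh r ^ 2 * h4 - Real.sinh r ^ 2 * h3) / 2

theorem circle_mem_sphere {o : X} {c r : ℝ} (hr : 0 ≤ r) (hy : φ.y o = 0)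
    (hz : φ.z o = Real.sinh c) (θ : ℝ) : φ.circle c r θ ∈ sphere o r := by
  have ht : φ.t o = Real.cosh c :=
    φ.t_eq_of_sq (Real.cosh_pos c).le (by rw [hy, hz, Real.cosh_sq]; ring)
  refine mem_sphere.2 (Real.cosh_injOn (mem_Ici.2 dist_nonneg) (mem_Ici.2 hr) ?_)
  rw [φ.cosh_dist, t_circle, z_circle, ht, hy, hz]
  linear_combination Real.cosh r * Real.cosh_sq c

theorem exists_circle_eq {o : X} {c r : ℝ} (hr : 0 < r) (hy : φ.y o = 0)
    (hz : φ.z o = Real.sinh c) {x : X} (hx : x ∈ sphere o r) :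
    ∃ θ ∈ Icc (-Real.pi) Real.pi, φ.circle c r θ = x := by
  have ht : φ.t o = Real.cosh c :=
    φ.t_eq_of_sq (Real.cosh_pos c).le (by rw [hy, hz, Real.cosh_sq]; ring)
  have hs : 0 < Real.sinh r := Real.sinh_pos_iff.2 hr
  have h1 := φ.cosh_dist x o
  rw [mem_sphere.1 hx, ht, hy, hz] at h1
  set u := φ.t x * Real.sinh c - φ.z x * Real.cosh c with hu
  have e1 := Real.cosh_sq r
  have e2 := Real.cosh_sq c
  have huy : u ^ 2 + φ.y x ^ 2 = Real.sinh r ^ 2 := by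
    rw [h1] at e1
    linear_combination e1 - φ.t_sq x + (φ.z x ^ 2 - φ.t x ^ 2) * e2
  set w : ℂ := ⟨u, φ.y x⟩ with hw
  have hn : ‖w‖ = Real.sinh r := by
    rw [Complex.norm_eq_sqrt_sq_add_sq, huy, Real.sqrt_sq hs.le]
  have hw0 : w ≠ 0 := norm_pos_iff.1 (by rw [hn]; exact hs)
  refine ⟨w.arg, ⟨(Complex.neg_pi_lt_arg w).le, Complex.arg_le_pi w⟩, φ.ext_yz ?_ ?_⟩
  · rw [y_circle, Complex.sin_arg, hn]
    field_simp
    rfl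
  · rw [z_circle, Complex.cos_arg hw0, hn, mul_right_comm, mul_div_cancel₀ _ hs.ne']
    show _ - u * _ = _
    rw [h1, hu]
    linear_combination φ.z x * e2

theorem sphere_inter_eq_image {o : X} {c r l ω : ℝ} (hr : 0 < r) (hy : φ.y o = 0)
    (hz : φ.z o = Real.sinh c) (hω : ω ∈ Icc 0 Real.pi)
    (hl : Real.sinh l = Real.cosh r * Real.sinh c - Real.sinh r * Real.cosh c * Real.cos ω) :
    sphere o r ∩ {x | φ.z x ≤ Real.sinh l} = φ.circle c r '' Icc (-ω) ω := by
  have hsc : 0 < Real.sinh r * Real.cosh c := mul_pos (Real.sinh_pos_iff.2 hr) (Real.cosh_pos c)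
  have key : ∀ θ ∈ Icc (-Real.pi) Real.pi,
      φ.z (φ.circle c r θ) ≤ Real.sinh l ↔ θ ∈ Icc (-ω) ω := fun θ hθ => by
    rw [z_circle, hl, sub_le_sub_iff_left, mul_le_mul_iff_right₀ hsc, ← Real.cos_abs θ,
      Real.strictAntiOn_cos.le_iff_ge hω ⟨abs_nonneg θ, abs_le.2 hθ⟩, abs_le]
    rfl
  apply Subset.antisymm
  · rintro x ⟨hx, hxl⟩
    obtain ⟨θ, hθ, rfl⟩ := φ.exists_circle_eq hr hy hz hx
    exact mem_image_of_mem _ ((key θ hθ).1 hxl)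
  · rintro _ ⟨θ, hθ, rfl⟩
    exact ⟨φ.circle_mem_sphere hr.le hy hz θ,
      (key θ ⟨by linarith [hθ.1, hω.2], hθ.2.trans hω.2⟩).2 hθ⟩

theorem injOn_circle {c r ω : ℝ} (hr : 0 < r) (hω : ω ≤ Real.pi) :
    InjOn (φ.circle c r) (Ico (-ω) ω) := by
  intro a ha b hb hab
  have h := φ.sinh_half_dist_circle c hr.le a b
  rw [hab, dist_self, zero_div, Real.sinh_zero, eq_comm, mul_eq_zero, abs_eq_zero,
    Real.sin_eq_zero_iff_of_lt_of_lt (by linarith [ha.1, hb.2]) (by linarith [ha.2, hb.1])] at h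
  rcases h with h | h
  · exact absurd h (Real.sinh_pos_iff.2 hr).ne'
  · linarith

theorem lipschitzWith_circle (c : ℝ) {r : ℝ} (hr : 0 ≤ r) :
    LipschitzWith (Real.sinh r).toNNReal (φ.circle c r) := by
  have hs : 0 ≤ Real.sinh r := Real.sinh_nonneg_iff.2 hr
  refine LipschitzWith.of_dist_le_mul fun a b => ?_
  have h := φ.sinh_half_dist_circle c hr a b
  have h1 := Real.self_le_sinh_iff.2 (by positivity :
    0 ≤ dist (φ.circle c r a) (φ.circle c r b) / 2)
  have h2 : |Real.sin ((a - b) / 2)| ≤ |(a - b) / 2| := Real.abs_sin_le_abs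
  rw [abs_div, abs_two] at h2
  rw [Real.coe_toNNReal _ hs, Real.dist_eq]
  nlinarith [mul_le_mul_of_nonneg_left h2 hs]

/-- Locally, the circle parametrization expands distances almost by the factor `sinh r`. -/
theorem exists_mul_le_dist_circle (c : ℝ) {r K : ℝ} (hr : 0 ≤ r)
    (hK : K < Real.sinh r) :
    ∃ δ > 0, ∀ a b, |a - b| ≤ δ → K * |a - b| ≤ dist (φ.circle c r a) (φ.circle c r b) := by
  have hder : HasDerivAt (fun h : ℝ => Real.sinh r * Real.sin (h / 2) - Real.sinh (K * h / 2))
      ((Real.sinh r - K) / 2) 0 := by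
    have h1 : HasDerivAt (fun h : ℝ => h / 2) (1 / 2) 0 := (hasDerivAt_id 0).div_const 2
    have h2 : HasDerivAt (fun h : ℝ => K * h / 2) (K * 1 / 2) 0 :=
      ((hasDerivAt_id 0).const_mul K).div_const 2
    refine ((h1.sin.const_mul (Real.sinh r)).sub h2.sinh).congr_deriv ?_
    simp only [zero_div, mul_zero, Real.cos_zero, Real.cosh_zero]
    ring
  have hev := (hasDerivAt_iff_tendsto_slope_zero.1 hder).eventually_const_lt
    (by linarith : 0 < (Real.sinh r - K) / 2)
  obtain ⟨ε, hε, hball⟩ := Metric.mem_nhdsWithin_iff.1 hev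
  refine ⟨min (ε / 2) 1, by positivity, fun a b hab => ?_⟩
  rcases (abs_nonneg (a - b)).eq_or_lt with h0 | h0
  · rw [← h0, mul_zero]
    exact dist_nonneg
  have h1 : |a - b| ∈ Metric.ball 0 ε ∩ {0}ᶜ := by
    refine ⟨?_, h0.ne'⟩
    rw [Metric.mem_ball, dist_zero_right, Real.norm_eq_abs, abs_abs]
    linarith [hab.trans (min_le_left _ _)]
  have h2 := hball h1
  simp only [mem_ofPred_eq, zero_add, zero_div, mul_zero, Real.sin_zero, Real.sinh_zero, sub_zero,
    smul_eq_mul] at h2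
  have h3 := (pos_iff_pos_of_mul_pos h2).1 (inv_pos.2 h0)
  have h4 : |Real.sin ((a - b) / 2)| = Real.sin (|a - b| / 2) := by
    have h5 : |a - b| ≤ 1 := hab.trans (min_le_right _ _)
    rw [Real.abs_sin_eq_sin_abs_of_abs_le_pi, abs_div, abs_two]
    rw [abs_div, abs_two]
    linarith [Real.pi_gt_three]
  have h6 := φ.sinh_half_dist_circle c hr a b
  rw [h4] at h6
  have := Real.sinh_le_sinh.1 (by rw [h6]; linarith :
    Real.sinh (K * |a - b| / 2) ≤ Real.sinh (dist (φ.circle c r a) (φ.circle c r b) / 2))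
  linarith

end HypChart

section Hausdorff

open MeasureTheory

variable [MeasurableSpace X] [BorelSpace X]

theorem ofReal_mul_le_hausdorffMeasure_image_Icc {γ : ℝ → X} {K a b : ℝ} (hK : 0 < K)
    (h : ∀ x ∈ Icc a b, ∀ y ∈ Icc a b, K * |x - y| ≤ dist (γ x) (γ y)) :
    ENNReal.ofReal (K * (b - a)) ≤ μH[1] (γ '' Icc a b) := by
  have hinj : InjOn γ (Icc a b) := fun x hx y hy hxy => by
    have h1 := h x hx y hy
    rw [hxy, dist_self] at h1
    have h2 : |x - y| ≤ 0 := by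
      by_contra! h3
      exact absurd h1 (not_le.2 (mul_pos hK h3))
    exact sub_eq_zero.1 (abs_nonpos_iff.1 h2)
  have hlip : LipschitzOnWith K⁻¹.toNNReal (Function.invFunOn γ (Icc a b)) (γ '' Icc a b) := by
    refine LipschitzOnWith.of_dist_le_mul ?_
    rintro _ ⟨x, hx, rfl⟩ _ ⟨y, hy, rfl⟩
    rw [hinj.leftInvOn_invFunOn hx, hinj.leftInvOn_invFunOn hy,
      Real.coe_toNNReal _ (inv_pos.2 hK).le, Real.dist_eq, inv_mul_eq_div, le_div_iff₀ hK, mul_comm]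
    exact h x hx y hy
  have h1 := hlip.hausdorffMeasure_image_le zero_le_one
  rw [hinj.leftInvOn_invFunOn.image_image, hausdorffMeasure_real, Real.volume_Icc,
    ENNReal.rpow_one] at h1
  calc ENNReal.ofReal (K * (b - a)) = ENNReal.ofReal K * ENNReal.ofReal (b - a) :=
        ENNReal.ofReal_mul hK.le
    _ ≤ ENNReal.ofReal K * (ENNReal.ofReal K⁻¹ * μH[1] (γ '' Icc a b)) := by gcongr; exact h1
    _ = μH[1] (γ '' Icc a b) := by
        rw [← mul_assoc, ← ENNReal.ofReal_mul hK.le, mul_inv_cancel₀ hK.ne', ENNReal.ofReal_one,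
          one_mul]

theorem ofReal_mul_le_hausdorffMeasure_image_Icc_add {γ : ℝ → X} (hγ : Continuous γ) {K δ : ℝ}
    (hK : 0 < K) (hδ : 0 ≤ δ) (h : ∀ x y, |x - y| ≤ δ → K * |x - y| ≤ dist (γ x) (γ y))
    (a : ℝ) (n : ℕ) (hinj : InjOn γ (Ico a (a + n * δ))) :
    ENNReal.ofReal (K * (n * δ)) ≤ μH[1] (γ '' Icc a (a + n * δ)) := by
  induction n with
  | zero => simp
  | succ n ih =>
    have hb : a ≤ a + n * δ := by linarith [mul_nonneg n.cast_nonneg' hδ]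
    have hc : a + (n + 1 : ℕ) * δ = a + n * δ + δ := by push_cast; ring
    rw [hc] at hinj ⊢
    set b := a + n * δ with hb_def
    have hbc : b ≤ b + δ := by linarith
    have h1 := ih (hinj.mono (Ico_subset_Ico_right hbc))
    have h2 := ofReal_mul_le_hausdorffMeasure_image_Icc (γ := γ) (a := b) (b := b + δ) hK
      fun x hx y hy =>
      h x y (abs_le.2 ⟨by linarith [hx.1, hy.2], by linarith [hx.2, hy.1]⟩)
    have := Measure.nullSingletonClass_hausdorff X (zero_lt_one (α := ℝ))
    have hdisj : AEDisjoint μH[1] (γ '' Icc a b) (γ '' Icc b (b + δ)) := by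
      refine measure_mono_null (t := {γ b, γ (b + δ)}) ?_ ((toFinite _).measure_zero _)
      rintro _ ⟨⟨x, hx, rfl⟩, y, hy, hxy⟩
      rcases hy.2.eq_or_lt with hy' | hy'
      · exact Or.inr (by rw [← hxy, hy']; rfl)
      · have : y = x := hinj ⟨hb.trans hy.1, hy'⟩ ⟨hx.1, by linarith [hx.2, hy.1]⟩ hxy
        exact Or.inl (by rw [le_antisymm hx.2 (this ▸ hy.1)])
    rw [← Icc_union_Icc_eq_Icc hb hbc, image_union, measure_union₀
      (isCompact_Icc.image hγ).measurableSet.nullMeasurableSet hdisj]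
    calc ENNReal.ofReal (K * ((n + 1 : ℕ) * δ))
        = ENNReal.ofReal (K * (n * δ)) + ENNReal.ofReal (K * (b + δ - b)) := by
          rw [← ENNReal.ofReal_add (by positivity) (mul_nonneg hK.le (by linarith))]
          push_cast
          ring_nf
      _ ≤ _ := add_le_add h1 h2

/-- The length of a circular arc with half central angle `ω`. -/
theorem HypChart.hausdorffMeasure_circle_image (φ : HypChart X) {c r ω : ℝ} (hr : 0 < r)
    (hω : ω ∈ Icc 0 Real.pi) :
    (μH[1] (φ.circle c r '' Icc (-ω) ω)).toReal = 2 * ω * Real.sinh r := by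
  have hs : 0 < Real.sinh r := Real.sinh_pos_iff.2 hr
  have hle : μH[1] (φ.circle c r '' Icc (-ω) ω) ≤ ENNReal.ofReal (2 * ω * Real.sinh r) := by
    have := (φ.lipschitzWith_circle c hr.le).hausdorffMeasure_image_le zero_le_one (Icc (-ω) ω)
    rw [hausdorffMeasure_real, Real.volume_Icc, ENNReal.rpow_one] at this
    refine this.trans_eq ?_
    rw [mul_comm (2 * ω), ENNReal.ofReal_mul hs.le, show ω - -ω = 2 * ω by ring]
    rfl
  have hfin := (hle.trans_lt ENNReal.ofReal_lt_top).ne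
  have hω0 : 0 ≤ 2 * ω * Real.sinh r := mul_nonneg (by linarith [hω.1]) hs.le
  refine le_antisymm (ENNReal.toReal_le_of_le_ofReal hω0 hle) ?_
  rcases hω.1.eq_or_lt with h0 | h0
  · rw [← h0]
    simp
  by_contra! hlt
  set m := (μH[1] (φ.circle c r '' Icc (-ω) ω)).toReal with hm
  have hm0 : 0 ≤ m := ENNReal.toReal_nonneg
  have hmK : m / (2 * ω) < Real.sinh r := (div_lt_iff₀' (by linarith)).2 hlt
  obtain ⟨K, hK1, hK2⟩ := exists_between hmK
  have hK : 0 < K := lt_of_le_of_lt (by positivity) hK1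
  obtain ⟨δ, hδ, hdist⟩ := φ.exists_mul_le_dist_circle c hr.le hK2
  obtain ⟨n, hn⟩ := exists_nat_gt (2 * ω / δ)
  have hn0 : (0 : ℝ) < n := lt_of_le_of_lt (by positivity) hn
  have hnδ : 2 * ω / n ≤ δ := (div_le_iff₀ hn0).2 (by
    rw [div_lt_iff₀ hδ] at hn
    linarith)
  have he : -ω + n * (2 * ω / n) = ω := by
    field_simp
    ring
  have := ofReal_mul_le_hausdorffMeasure_image_Icc_add (φ.continuous_circle c r) hK
    (δ := 2 * ω / n) (by positivity) (fun x y hxy => hdist x y (hxy.trans hnδ)) (-ω) n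
    (by rw [he]; exact φ.injOn_circle hr hω.2)
  rw [he, ENNReal.ofReal_le_iff_le_toReal hfin, ← hm, mul_div_cancel₀ _ hn0.ne'] at this
  rw [div_lt_iff₀ (by linarith)] at hK1
  linarith

end Hausdorff

theorem abs_sub_le_iff_exists_cos {c l r : ℝ} (hr : 0 < r) :
    |c - l| ≤ r ↔ ∃ θ ∈ Icc 0 Real.pi,
      Real.sinh l = Real.cosh r * Real.sinh c - Real.sinh r * Real.cosh c * Real.cos θ := by
  have hsc : 0 < Real.sinh r * Real.cosh c := mul_pos (Real.sinh_pos_iff.2 hr) (Real.cosh_pos c)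
  have hiff : |c - l| ≤ r ↔ Real.sinh (c - r) ≤ Real.sinh l ∧ Real.sinh l ≤ Real.sinh (c + r) := by
    rw [Real.sinh_le_sinh, Real.sinh_le_sinh, abs_le]
    constructor <;> rintro ⟨h1, h2⟩ <;> constructor <;> linarith
  rw [hiff, Real.sinh_sub, Real.sinh_add]
  constructor
  · rintro ⟨h1, h2⟩
    set q := (Real.cosh r * Real.sinh c - Real.sinh l) / (Real.sinh r * Real.cosh c) with hq
    refine ⟨Real.arccos q, ⟨Real.arccos_nonneg q, Real.arccos_le_pi q⟩, ?_⟩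
    rw [Real.cos_arccos ((le_div_iff₀ hsc).2 (by linarith)) ((div_le_iff₀ hsc).2 (by linarith)),
      mul_div_cancel₀ _ hsc.ne']
    ring
  · rintro ⟨θ, -, h⟩
    rw [h]
    constructor <;> nlinarith [Real.neg_one_le_cos θ, Real.cos_le_one θ]

open MeasureTheory in
/-- **Lemma 5.1.** In the hyperbolic plane, for a hypercycle `H` at signed distance `l`
from the base line of the half-plane `P`, and a circle `C` of centre `o` and radius
`r > 0` whose centre is at signed distance `c` from this base line: `C ∩ H ≠ ∅` iff
`|c - l| ≤ r`; and in this case the half central angle `ω` of the arc `C ∩ H⁻`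
(computed from its arclength, i.e. its one-dimensional Hausdorff measure, which equals
`2 ω sinh r`) satisfies `sinh l = cosh r · sinh c − sinh r · cosh c · cos ω`. -/
theorem lemma5_1
    (X : Type*) [MetricSpace X] [MeasurableSpace X] [BorelSpace X]
    (hX : IsHyperbolicSpace X 2)
    (P : Set X) (hP : IsHalfspace P)
    (l : ℝ) (o : X) (r : ℝ) (hr : 0 < r) (c : ℝ) (hc : c = sdist P o) :
    ((sphere o r ∩ {x | sdist P x = l}).Nonempty ↔ |c - l| ≤ r) ∧
    (|c - l| ≤ r →
      Real.sinh l =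
        Real.cosh r * Real.sinh c -
          Real.sinh r * Real.cosh c *
            Real.cos ((μH[1] (sphere o r ∩ {x | sdist P x ≤ l})).toReal /
              (2 * Real.sinh r))) := by
  obtain ⟨φ₀, rfl⟩ := hP.exists_hypChart hX
  obtain ⟨φ, hy, hφ⟩ := φ₀.exists_y_eq_zero o
  rw [← hφ] at hc ⊢
  simp only [φ.sdist_eq_arsinh] at hc ⊢
  have hz : φ.z o = Real.sinh c := by rw [hc, Real.sinh_arsinh]
  have hs : 0 < Real.sinh r := Real.sinh_pos_iff.2 hr
  refine ⟨⟨?_, fun h => ?_⟩, fun h => ?_⟩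
  · rintro ⟨x, hx, hxl⟩
    obtain ⟨θ, -, rfl⟩ := φ.exists_circle_eq hr hy hz hx
    refine (abs_sub_le_iff_exists_cos hr).2
      ⟨Real.arccos (Real.cos θ), ⟨Real.arccos_nonneg _, Real.arccos_le_pi _⟩, ?_⟩
    rw [Real.cos_arccos (Real.neg_one_le_cos θ) (Real.cos_le_one θ), ← φ.z_circle,
      ← show Real.arsinh _ = l from hxl, Real.sinh_arsinh]
  · obtain ⟨θ, -, hl⟩ := (abs_sub_le_iff_exists_cos hr).1 h
    refine ⟨φ.circle c r θ, φ.circle_mem_sphere hr.le hy hz θ, ?_⟩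
    rw [mem_ofPred_eq, φ.z_circle, ← hl, Real.arsinh_sinh]
  · obtain ⟨ω, hω, hl⟩ := (abs_sub_le_iff_exists_cos hr).1 h
    have hset : {x | Real.arsinh (φ.z x) ≤ l} = {x | φ.z x ≤ Real.sinh l} := by
      ext x
      rw [mem_ofPred_eq, mem_ofPred_eq, ← Real.sinh_le_sinh, Real.sinh_arsinh]
    rw [hset, φ.sphere_inter_eq_image hr hy hz hω hl, φ.hausdorffMeasure_circle_image hr hω,
      show 2 * ω * Real.sinh r / (2 * Real.sinh r) = ω by field_simp]
    exact hl

end BallChar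
end

section
/- Assume K, L ⊊ H² are proper closed convex sets with nonempty interior such that the pair K, L falls into one of the cases (A), (B), (C), (D), (E). Then for all orientation-preserving congruences φ, ψ of H² with int((φK) ∩ (ψL)) ≠ ∅, the set (φK) ∩ (ψL) is axially symmetric. -/
open Metric Set Filter

namespace BallChar

variable {X : Type*} [MetricSpace X]

/-! ### The Minkowski form on `ℝ³` -/

/-- The Minkowski form on `ℝ³`, with the last coordinate timelike. -/
def lor (u v : ℝ × ℝ × ℝ) : ℝ := u.1 * v.1 + u.2.1 * v.2.1 - u.2.2 * v.2.2

/-- The Minkowski cross product on `ℝ³`. -/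
def lcross (u v : ℝ × ℝ × ℝ) : ℝ × ℝ × ℝ :=
  (u.2.1 * v.2.2 - u.2.2 * v.2.1, u.2.2 * v.1 - u.1 * v.2.2, u.2.1 * v.1 - u.1 * v.2.1)

lemma lor_comm (u v : ℝ × ℝ × ℝ) : lor u v = lor v u := by simp only [lor]; ring

lemma lor_add_left (u v w : ℝ × ℝ × ℝ) : lor (u + v) w = lor u w + lor v w := by
  simp only [lor, Prod.fst_add, Prod.snd_add]; ring

lemma lor_sub_left (u v w : ℝ × ℝ × ℝ) : lor (u - v) w = lor u w - lor v w := by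
  simp only [lor, Prod.fst_sub, Prod.snd_sub]; ring

lemma lor_smul_left (c : ℝ) (u w : ℝ × ℝ × ℝ) : lor (c • u) w = c * lor u w := by
  simp only [lor, Prod.smul_fst, Prod.smul_snd, smul_eq_mul]; ring

lemma lor_neg_left (u w : ℝ × ℝ × ℝ) : lor (-u) w = -lor u w := by
  simp only [lor, Prod.fst_neg, Prod.snd_neg]; ring

lemma lor_add_right (u v w : ℝ × ℝ × ℝ) : lor u (v + w) = lor u v + lor u w := by
  simp only [lor, Prod.fst_add, Prod.snd_add]; ring

lemma lor_sub_right (u v w : ℝ × ℝ × ℝ) : lor u (v - w) = lor u v - lor u w := by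
  simp only [lor, Prod.fst_sub, Prod.snd_sub]; ring

lemma lor_smul_right (c : ℝ) (u w : ℝ × ℝ × ℝ) : lor u (c • w) = c * lor u w := by
  simp only [lor, Prod.smul_fst, Prod.smul_snd, smul_eq_mul]; ring

lemma lor_neg_right (u w : ℝ × ℝ × ℝ) : lor u (-w) = -lor u w := by
  simp only [lor, Prod.fst_neg, Prod.snd_neg]; ring

lemma lor_lcross_left (u v : ℝ × ℝ × ℝ) : lor (lcross u v) u = 0 := by
  simp only [lor, lcross]; ring

lemma lor_lcross_right (u v : ℝ × ℝ × ℝ) : lor (lcross u v) v = 0 := by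
  simp only [lor, lcross]; ring

lemma lor_lcross_self (u v : ℝ × ℝ × ℝ) :
    lor (lcross u v) (lcross u v) = lor u v ^ 2 - lor u u * lor v v := by
  simp only [lor, lcross]; ring

/-- A vector orthogonal to a timelike vector is spacelike or zero. -/
lemma eq_zero_of_lor_timelike {v w : ℝ × ℝ × ℝ} (hv : lor v v < 0) (hvw : lor w v = 0)
    (hw : lor w w ≤ 0) : w = 0 := by
  obtain ⟨a, b, c⟩ := v
  obtain ⟨x, y, z⟩ := w
  simp only [lor] at hv hvw hw
  have hc : 0 < c ^ 2 := by nlinarith [sq_nonneg a, sq_nonneg b]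
  have key : c ^ 2 * (x ^ 2 + y ^ 2 - z ^ 2) ≥ (c ^ 2 - a ^ 2 - b ^ 2) * (x ^ 2 + y ^ 2) := by
    have h1 : c * z = x * a + y * b := by linarith
    have h2 : c ^ 2 * z ^ 2 = (x * a + y * b) ^ 2 := by rw [← h1]; ring
    nlinarith [sq_nonneg (x * b - y * a)]
  have hxy : x ^ 2 + y ^ 2 ≤ 0 := by
    by_contra h
    push Not at h
    have : 0 < (c ^ 2 - a ^ 2 - b ^ 2) * (x ^ 2 + y ^ 2) := mul_pos (by nlinarith) h
    nlinarith
  have hx : x = 0 := by nlinarith [sq_nonneg x, sq_nonneg y]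
  have hy : y = 0 := by nlinarith [sq_nonneg x, sq_nonneg y]
  subst hx hy
  have hz : z = 0 := by
    have : c * z = 0 := by linarith
    rcases mul_eq_zero.1 this with h | h
    · rw [h] at hc; norm_num at hc
    · exact h
  simp [hz]

lemma lor_neg_of_pos {u v : ℝ × ℝ × ℝ} (hu : lor u u ≤ 0) (hv : lor v v < 0)
    (hu' : 0 < u.2.2) (hv' : 0 < v.2.2) : lor u v < 0 := by
  obtain ⟨a, b, c⟩ := u
  obtain ⟨x, y, z⟩ := v
  simp only [lor] at *
  have h : (a * x + b * y) ^ 2 < (c * z) ^ 2 := by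
    have h1 : (a * x + b * y) ^ 2 ≤ (a ^ 2 + b ^ 2) * (x ^ 2 + y ^ 2) := by
      nlinarith [sq_nonneg (a * y - b * x)]
    have h2 : (a ^ 2 + b ^ 2) * (x ^ 2 + y ^ 2) ≤ c ^ 2 * (x ^ 2 + y ^ 2) :=
      mul_le_mul_of_nonneg_right (by nlinarith) (by positivity)
    have h3 : c ^ 2 * (x ^ 2 + y ^ 2) < c ^ 2 * z ^ 2 :=
      mul_lt_mul_of_pos_left (by nlinarith) (by positivity)
    nlinarith
  have := abs_lt_of_sq_lt_sq h (by positivity)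
  linarith [(abs_lt.1 this).2]

/-- Every vector has a spacelike vector orthogonal to it. -/
lemma exists_spacelike_perp_pair {v w : ℝ × ℝ × ℝ} (h : lcross v w = 0) :
    ∃ m, 0 < lor m m ∧ lor m v = 0 ∧ lor m w = 0 := by
  obtain ⟨a, b, c⟩ := v
  obtain ⟨x, y, z⟩ := w
  simp only [lcross, Prod.mk_eq_zero] at h
  obtain ⟨-, -, h⟩ := h
  by_cases h1 : a ^ 2 + b ^ 2 = 0
  · have ha : a = 0 := by nlinarith [sq_nonneg a, sq_nonneg b]
    have hb : b = 0 := by nlinarith [sq_nonneg a, sq_nonneg b]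
    by_cases h2 : x ^ 2 + y ^ 2 = 0
    · have hx : x = 0 := by nlinarith [sq_nonneg x, sq_nonneg y]
      have hy : y = 0 := by nlinarith [sq_nonneg x, sq_nonneg y]
      exact ⟨(1, 0, 0), by simp [lor], by simp [lor, ha], by simp [lor, hx]⟩
    · refine ⟨(-y, x, 0), ?_, by simp [lor, ha, hb], by simp only [lor]; ring⟩
      have : 0 < x ^ 2 + y ^ 2 := lt_of_le_of_ne (by positivity) (Ne.symm h2)
      simp only [lor]; nlinarith
  · refine ⟨(-b, a, 0), ?_, by simp only [lor]; ring, by simp only [lor]; linarith⟩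
    have : 0 < a ^ 2 + b ^ 2 := lt_of_le_of_ne (by positivity) (Ne.symm h1)
    simp only [lor]; nlinarith

lemma exists_spacelike_perp (v : ℝ × ℝ × ℝ) : ∃ m, 0 < lor m m ∧ lor m v = 0 := by
  obtain ⟨m, h1, h2, -⟩ := exists_spacelike_perp_pair (v := v) (w := v) (by
    simp only [lcross, Prod.mk_eq_zero]; exact ⟨by ring, by ring, by ring⟩)
  exact ⟨m, h1, h2⟩

/-- A timelike vector and any vector, or two causal vectors, have a common spacelike
orthogonal vector. -/
lemma exists_spacelike_perp_of_causal {v w : ℝ × ℝ × ℝ}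
    (h : lor v v < 0 ∨ (lor v v ≤ 0 ∧ lor w w ≤ 0)) :
    ∃ m, 0 < lor m m ∧ lor m v = 0 ∧ lor m w = 0 := by
  by_cases hc : 0 < lor (lcross v w) (lcross v w)
  · exact ⟨lcross v w, hc, lor_lcross_left v w, lor_lcross_right v w⟩
  push Not at hc
  apply exists_spacelike_perp_pair
  by_cases hv : lor v v < 0
  · exact eq_zero_of_lor_timelike hv (lor_lcross_left v w) hc
  by_cases hw : lor w w < 0
  · exact eq_zero_of_lor_timelike hw (lor_lcross_right v w) hc
  have hv0 : lor v v = 0 := by rcases h with h | h <;> linarith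
  have hw0 : lor w w = 0 := by rcases h with h | h <;> linarith
  rw [lor_lcross_self, hv0, hw0] at hc
  have hvw : lor v w = 0 := by nlinarith [sq_nonneg (lor v w)]
  obtain ⟨a, b, c⟩ := v
  obtain ⟨x, y, z⟩ := w
  simp only [lor] at hv0 hw0 hvw
  have h1 : (a * y - b * x) ^ 2 = 0 := by
    linear_combination (x * x + y * y) * hv0 + c * c * hw0 - (a * x + b * y + c * z) * hvw
  have h2 : (b * z - c * y) ^ 2 = 0 := by
    linear_combination h1 - b ^ 2 * hw0 - y ^ 2 * hv0 + 2 * b * y * hvw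
  have h3 : (c * x - a * z) ^ 2 = 0 := by
    linear_combination h1 - a ^ 2 * hw0 - x ^ 2 * hv0 + 2 * a * x * hvw
  have h1' := pow_eq_zero_iff (two_ne_zero) |>.1 h1
  simp only [lcross, Prod.mk_eq_zero]
  exact ⟨pow_eq_zero_iff (two_ne_zero) |>.1 h2, pow_eq_zero_iff (two_ne_zero) |>.1 h3,
    by linarith⟩

/-- Rescaling a spacelike vector to unit length. -/
lemma exists_unit_of_spacelike {m : ℝ × ℝ × ℝ} (h : 0 < lor m m) :
    ∃ c : ℝ, 0 < c ∧ lor (c • m) (c • m) = 1 := by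
  refine ⟨(Real.sqrt (lor m m))⁻¹, by positivity, ?_⟩
  rw [lor_smul_left, lor_smul_right, ← mul_assoc, ← mul_inv, Real.mul_self_sqrt h.le,
    inv_mul_cancel₀ h.ne']

/-- A Lorentz orthonormal frame with future timelike third vector. -/
structure LFrame (n m q : ℝ × ℝ × ℝ) : Prop where
  nn : lor n n = 1
  mm : lor m m = 1
  nm : lor n m = 0
  nq : lor n q = 0
  mq : lor m q = 0
  qq : lor q q = -1
  pos : 0 < q.2.2

lemma exists_lframe_of_orthonormal {n m : ℝ × ℝ × ℝ} (hn : lor n n = 1) (hm : lor m m = 1)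
    (hnm : lor n m = 0) : ∃ q, LFrame n m q := by
  have hq : lor (lcross n m) (lcross n m) = -1 := by
    rw [lor_lcross_self, hn, hm, hnm]; norm_num
  have h1 := lor_lcross_left n m
  have h2 := lor_lcross_right n m
  rw [lor_comm] at h1 h2
  rcases lt_trichotomy (lcross n m).2.2 0 with h | h | h
  · refine ⟨-lcross n m, hn, hm, hnm, ?_, ?_, ?_, ?_⟩
    · rw [lor_neg_right, h1, neg_zero]
    · rw [lor_neg_right, h2, neg_zero]
    · rw [lor_neg_right, lor_neg_left, hq]; norm_num
    · simpa using h
  · exfalso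
    simp only [lor] at hq
    rw [h] at hq
    nlinarith [sq_nonneg (lcross n m).1, sq_nonneg (lcross n m).2.1]
  · exact ⟨_, hn, hm, hnm, h1, h2, hq, h⟩

lemma exists_lframe_of_unit {n : ℝ × ℝ × ℝ} (hn : lor n n = 1) : ∃ m q, LFrame n m q := by
  obtain ⟨m, hm, hmn⟩ := exists_spacelike_perp n
  obtain ⟨c, -, hc⟩ := exists_unit_of_spacelike hm
  obtain ⟨q, hq⟩ := exists_lframe_of_orthonormal hn hc
    (by rw [lor_smul_right, lor_comm, hmn, mul_zero])
  exact ⟨_, q, hq⟩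

lemma exists_lframe_of_timelike {m q : ℝ × ℝ × ℝ} (hm : lor m m = 1) (hq : lor q q = -1)
    (hmq : lor m q = 0) (hpos : 0 < q.2.2) : ∃ n, LFrame n m q := by
  refine ⟨lcross m q, ?_, hm, lor_lcross_left m q, lor_lcross_right m q, hmq, hq, hpos⟩
  rw [lor_lcross_self, hm, hq, hmq]; norm_num

lemma LFrame.expand {n m q : ℝ × ℝ × ℝ} (h : LFrame n m q) (u : ℝ × ℝ × ℝ) :
    u = lor u n • n + lor u m • m - lor u q • q := by
  obtain ⟨n1, n2, n3⟩ := n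
  obtain ⟨m1, m2, m3⟩ := m
  obtain ⟨q1, q2, q3⟩ := q
  obtain ⟨a, b, c⟩ := u
  obtain ⟨hnn, hmm, hnm, hnq, hmq, hqq, -⟩ := h
  simp only [lor] at hnn hmm hnm hnq hmq hqq
  have hAB : (!![n1, n2, -n3; m1, m2, -m3; -q1, -q2, q3] : Matrix (Fin 3) (Fin 3) ℝ) *
      !![n1, m1, q1; n2, m2, q2; n3, m3, q3] = 1 := by
    ext i j
    fin_cases i <;> fin_cases j <;>
      simp [Matrix.mul_apply, Fin.sum_univ_succ] <;> linarith
  have hBA := mul_eq_one_comm.1 hAB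
  have e : ∀ i j, _ := fun i j => congrFun (congrFun hBA i) j
  have e00 := e 0 0
  have e01 := e 0 1
  have e02 := e 0 2
  have e10 := e 1 0
  have e11 := e 1 1
  have e12 := e 1 2
  have e20 := e 2 0
  have e21 := e 2 1
  have e22 := e 2 2
  simp [Matrix.mul_apply, Fin.sum_univ_succ] at e00 e01 e02 e10 e11 e12 e20 e21 e22
  simp only [lor, Prod.smul_mk, smul_eq_mul, Prod.mk_add_mk, Prod.mk_sub_mk, Prod.mk.injEq]
  refine ⟨?_, ?_, ?_⟩
  · linear_combination -a * e00 - b * e01 - c * e02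
  · linear_combination -a * e10 - b * e11 - c * e12
  · linear_combination -a * e20 - b * e21 - c * e22

lemma LFrame.lor_eq {n m q : ℝ × ℝ × ℝ} (h : LFrame n m q) (u v : ℝ × ℝ × ℝ) :
    lor u v = lor u n * lor v n + lor u m * lor v m - lor u q * lor v q := by
  conv_lhs => rw [h.expand v]
  rw [lor_sub_right, lor_add_right, lor_smul_right, lor_smul_right, lor_smul_right]
  ring

/-! ### The hyperboloid model in coordinates -/

/-- `j` identifies `X` with the upper sheet of the hyperboloid in `ℝ³`. -/
structure HModel (j : X → ℝ × ℝ × ℝ) : Prop where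
  norm : ∀ x, lor (j x) (j x) = -1
  pos : ∀ x, 0 < (j x).2.2
  surj : ∀ u, lor u u = -1 → 0 < u.2.2 → ∃ x, j x = u
  cosh_dist : ∀ x y, Real.cosh (dist x y) = -lor (j x) (j y)

lemma IsHyperbolicSpace.exists_hmodel (hX : IsHyperbolicSpace X 2) :
    ∃ j : X → ℝ × ℝ × ℝ, HModel j := by
  obtain ⟨e, -, hr, hd⟩ := hX
  have hmink : ∀ u v : EuclideanSpace ℝ (Fin 2) × ℝ,
      mink 2 u v = lor (u.1 0, u.1 1, u.2) (v.1 0, v.1 1, v.2) := by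
    intro u v
    simp [mink, lor, PiLp.inner_apply, Fin.sum_univ_two]
    ring
  have hmem : ∀ x, mink 2 (e x) (e x) = -1 ∧ 0 < (e x).2 := fun x => by
    have : e x ∈ {u | mink 2 u u = -1 ∧ 0 < u.2} := hr ▸ mem_range_self x
    exact this
  refine ⟨fun x => ((e x).1 0, (e x).1 1, (e x).2), fun x => ?_, fun x => (hmem x).2, ?_, ?_⟩
  · rw [← hmink]; exact (hmem x).1
  · intro u hu hpos
    have : ((!₂[u.1, u.2.1], u.2.2) : EuclideanSpace ℝ (Fin 2) × ℝ) ∈ range e := by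
      rw [hr]
      refine ⟨?_, hpos⟩
      rw [hmink]
      simpa using hu
    obtain ⟨x, hx⟩ := this
    exact ⟨x, by simp [hx]⟩
  · intro x y
    rw [hd, hmink]

namespace HModel

variable {j : X → ℝ × ℝ × ℝ}

lemma dist_eq (hj : HModel j) (x y : X) : dist x y = Real.arcosh (-lor (j x) (j y)) := by
  rw [← hj.cosh_dist, Real.arcosh_cosh dist_nonneg]

lemma injective (hj : HModel j) : Function.Injective j := by
  intro x y h
  apply dist_le_zero.1
  rw [hj.dist_eq, h, hj.norm]
  simp

lemma dist_le_iff (hj : HModel j) (x y : X) {r : ℝ} (hr : 0 ≤ r) :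
    dist x y ≤ r ↔ -lor (j x) (j y) ≤ Real.cosh r := by
  rw [← hj.cosh_dist, Real.cosh_le_cosh, abs_of_nonneg dist_nonneg, abs_of_nonneg hr]

lemma dist_lt_iff (hj : HModel j) (x y : X) {r : ℝ} (hr : 0 ≤ r) :
    dist x y < r ↔ -lor (j x) (j y) < Real.cosh r := by
  rw [← hj.cosh_dist, Real.cosh_lt_cosh, abs_of_nonneg dist_nonneg, abs_of_nonneg hr]

lemma lor_neg (hj : HModel j) (x y : X) : lor (j x) (j y) < 0 := by
  have := Real.cosh_pos (dist x y)
  rw [hj.cosh_dist] at this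
  linarith

/-- A vector of norm `-1` in the same cone as a point of the sheet is on the sheet. -/
lemma exists_of_lor_neg (hj : HModel j) {u : ℝ × ℝ × ℝ} (hu : lor u u = -1) {x : X}
    (hx : lor u (j x) < 0) : ∃ y, j y = u := by
  apply hj.surj u hu
  by_contra hneg
  have h0 : 0 < (-u).2.2 := by
    have : u.2.2 ≠ 0 := by
      intro h
      simp only [lor] at hu
      rw [h] at hu
      nlinarith [sq_nonneg u.1, sq_nonneg u.2.1]
    have := lt_of_le_of_ne (not_lt.1 hneg) this
    simpa using this
  have h1 := lor_neg_of_pos (u := -u) (v := j x)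
    (by rw [lor_neg_left, lor_neg_right, hu]; norm_num) (by rw [hj.norm]; norm_num) h0 (hj.pos x)
  rw [lor_neg_left] at h1
  linarith

lemma exists_span (hj : HModel j) : ∃ p₀ p₁ p₂ : X, ∀ v, ∃ a b c : ℝ,
    v = a • j p₀ + b • j p₁ + c • j p₂ := by
  have h2 : Real.sqrt 2 * Real.sqrt 2 = 2 := Real.mul_self_sqrt (by norm_num)
  obtain ⟨p₀, h₀⟩ := hj.surj (0, 0, 1) (by simp [lor]) (by simp)
  obtain ⟨p₁, h₁⟩ := hj.surj (1, 0, Real.sqrt 2) (by simp only [lor]; linarith) (by simp)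
  obtain ⟨p₂, h₂⟩ := hj.surj (0, 1, Real.sqrt 2) (by simp only [lor]; linarith) (by simp)
  refine ⟨p₀, p₁, p₂, fun v => ⟨v.2.2 - Real.sqrt 2 * (v.1 + v.2.1), v.1, v.2.1, ?_⟩⟩
  rw [h₀, h₁, h₂]
  ext <;> simp
  ring

lemma continuous_lor (hj : HModel j) (v : ℝ × ℝ × ℝ) : Continuous fun x => lor (j x) v := by
  obtain ⟨p₀, p₁, p₂, h⟩ := hj.exists_span
  obtain ⟨a, b, c, rfl⟩ := h v
  have : (fun x => lor (j x) (a • j p₀ + b • j p₁ + c • j p₂)) = fun x =>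
      -(a * Real.cosh (dist x p₀) + b * Real.cosh (dist x p₁) + c * Real.cosh (dist x p₂)) := by
    ext x
    simp only [hj.cosh_dist, lor_add_right, lor_smul_right]
    ring
  rw [this]
  have hd : ∀ p : X, Continuous fun x => Real.cosh (dist x p) := fun p =>
    Real.continuous_cosh.comp (continuous_id.dist continuous_const)
  exact (((continuous_const.mul (hd _)).add (continuous_const.mul (hd _))).add
    (continuous_const.mul (hd _))).neg

/-- Isometries act linearly on linear functionals and preserve the Minkowski norm. -/
lemma exists_adjoint (hj : HModel j) (g : X ≃ᵢ X) (v : ℝ × ℝ × ℝ) :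
    ∃ v', lor v' v' = lor v v ∧ ∀ x, lor (j (g x)) v = lor (j x) v' := by
  obtain ⟨p₀, p₁, p₂, h⟩ := hj.exists_span
  obtain ⟨a, b, c, rfl⟩ := h v
  have hg : ∀ x p, lor (j (g x)) (j p) = lor (j x) (j (g.symm p)) := by
    intro x p
    have h1 := hj.cosh_dist (g x) p
    have h2 := hj.cosh_dist x (g.symm p)
    rw [← g.dist_eq x, g.apply_symm_apply, h1] at h2
    linarith
  have hg' : ∀ x y, lor (j (g.symm x)) (j (g.symm y)) = lor (j x) (j y) := by
    intro x y
    rw [← hg, g.apply_symm_apply]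
  refine ⟨a • j (g.symm p₀) + b • j (g.symm p₁) + c • j (g.symm p₂), ?_, fun x => ?_⟩
  · simp only [lor_add_right, lor_smul_right, lor_add_left, lor_smul_left, hg']
  · simp only [lor_add_right, lor_smul_right, hg]

/-- The point of the model with given coordinates in a frame. -/
lemma exists_chart (hj : HModel j) {n m q : ℝ × ℝ × ℝ} (h : LFrame n m q) :
    ∃ G : ℝ × ℝ → X, Continuous G ∧ Function.Surjective G ∧
      (∀ w, lor (j (G w)) n = w.1) ∧ (∀ w, lor (j (G w)) m = w.2) ∧
      (∀ w, lor (j (G w)) q = -Real.sqrt (1 + w.1 ^ 2 + w.2 ^ 2)) ∧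
      ∀ x, x = G (lor (j x) n, lor (j x) m) := by
  obtain ⟨p, hp⟩ := hj.surj q h.qq h.pos
  have hs : ∀ w : ℝ × ℝ, Real.sqrt (1 + w.1 ^ 2 + w.2 ^ 2) * Real.sqrt (1 + w.1 ^ 2 + w.2 ^ 2) =
      1 + w.1 ^ 2 + w.2 ^ 2 := fun w => Real.mul_self_sqrt (by positivity)
  have hs0 : ∀ w : ℝ × ℝ, 0 < Real.sqrt (1 + w.1 ^ 2 + w.2 ^ 2) :=
    fun w => Real.sqrt_pos.2 (by positivity)
  have hmn : lor m n = 0 := by rw [lor_comm]; exact h.nm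
  have hqn : lor q n = 0 := by rw [lor_comm]; exact h.nq
  have hqm : lor q m = 0 := by rw [lor_comm]; exact h.mq
  have key : ∀ w : ℝ × ℝ, ∃ x, j x = w.1 • n + w.2 • m + Real.sqrt (1 + w.1 ^ 2 + w.2 ^ 2) • q := by
    intro w
    apply hj.exists_of_lor_neg (x := p)
    · simp only [lor_add_right, lor_add_left, lor_smul_left, lor_smul_right, h.nn, h.mm, h.nm,
        h.nq, h.mq, h.qq, hmn, hqn, hqm]
      linarith [hs w]
    · simp only [hp, lor_add_left, lor_smul_left, h.nq, h.mq, h.qq]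
      linarith [hs0 w]
  choose G hG using key
  have hn : ∀ w, lor (j (G w)) n = w.1 := fun w => by
    simp only [hG, lor_add_left, lor_smul_left, h.nn, hmn, hqn]; ring
  have hm : ∀ w, lor (j (G w)) m = w.2 := fun w => by
    simp only [hG, lor_add_left, lor_smul_left, h.mm, h.nm, hqm]; ring
  have hq : ∀ w, lor (j (G w)) q = -Real.sqrt (1 + w.1 ^ 2 + w.2 ^ 2) := fun w => by
    simp only [hG, lor_add_left, lor_smul_left, h.qq, h.nq, h.mq]; ring
  have hinv : ∀ x, x = G (lor (j x) n, lor (j x) m) := by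
    intro x
    apply hj.injective
    rw [hG]
    have h1 := h.expand (j x)
    have h2 := h.lor_eq (j x) (j x)
    have h3 : Real.sqrt (1 + lor (j x) n ^ 2 + lor (j x) m ^ 2) = -lor (j x) q := by
      rw [Real.sqrt_eq_iff_mul_self_eq (by positivity)]
      · rw [hj.norm] at h2; linarith
      · rw [← hp]; linarith [hj.lor_neg x p]
    simp only [h3]
    rw [neg_smul, ← sub_eq_add_neg]
    exact h1
  refine ⟨G, ?_, fun x => ⟨_, (hinv x).symm⟩, hn, hm, hq, hinv⟩
  rw [continuous_iff_continuousAt]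
  intro w₀
  rw [ContinuousAt, tendsto_iff_dist_tendsto_zero]
  have hc : Continuous fun w => Real.arcosh (-lor (j (G w)) (j (G w₀))) := by
    refine Real.continuousOn_arcosh.comp_continuous ?_ fun w => ?_
    · simp only [h.lor_eq (j (G _)) (j (G w₀)), hn, hm, hq]
      fun_prop
    · rw [mem_Ici, ← hj.cosh_dist]; exact Real.one_le_cosh _
  have := hc.tendsto w₀
  simp only [← hj.dist_eq, dist_self] at this
  exact this

/-- Every spacelike vector `m` induces a reflection in the line orthogonal to `m`. -/
lemma exists_reflection (hj : HModel j) {m : ℝ × ℝ × ℝ} (hm : 0 < lor m m) :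
    ∃ σ : X ≃ᵢ X, IsReflection σ ∧
      ∀ x v, lor (j (σ x)) v = lor (j x) (v - (2 * lor v m / lor m m) • m) := by
  have hex : ∀ x, ∃ y, j y = j x - (2 * lor (j x) m / lor m m) • m := by
    intro x
    apply hj.exists_of_lor_neg (x := x)
    · simp only [lor_sub_left, lor_sub_right, lor_smul_left, lor_smul_right, hj.norm,
        lor_comm m (j x)]
      field_simp
      ring
    · simp only [lor_sub_left, lor_smul_left, hj.norm, lor_comm m (j x)]
      have : 2 * lor (j x) m / lor m m * lor (j x) m = 2 * lor (j x) m ^ 2 / lor m m := by ring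
      rw [this]
      have : 0 ≤ 2 * lor (j x) m ^ 2 / lor m m := by positivity
      linarith
  choose s hs using hex
  have hlor : ∀ x v, lor (j (s x)) v = lor (j x) (v - (2 * lor v m / lor m m) • m) := by
    intro x v
    rw [hs]
    simp only [lor_sub_left, lor_sub_right, lor_smul_left, lor_smul_right, lor_comm m v]
    ring
  have hinv : ∀ x, s (s x) = x := by
    intro x
    apply hj.injective
    rw [hs (s x), hlor, hs x]
    have : lor (j x) (m - (2 * lor m m / lor m m) • m) = -lor (j x) m := by
      rw [lor_sub_right, lor_smul_right]; field_simp; ring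
    rw [this, sub_sub, ← add_smul]
    ring_nf
    simp
  have hiso : Isometry s := by
    refine Isometry.of_dist_eq fun x y => ?_
    rw [hj.dist_eq, hj.dist_eq, hlor, hs]
    congr 2
    simp only [lor_sub_left, lor_sub_right, lor_smul_left, lor_smul_right]
    field_simp
    ring
  let σ : X ≃ᵢ X := ⟨⟨s, s, hinv, hinv⟩, hiso⟩
  have hσ : ∀ x, σ x = s x := fun _ => rfl
  have hflip : ∀ x, lor (j (s x)) m = -lor (j x) m := by
    intro x
    rw [hlor, lor_sub_right, lor_smul_right]
    field_simp
    ring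
  obtain ⟨c, hc, hcm⟩ := exists_unit_of_spacelike hm
  obtain ⟨m', q, hF⟩ := exists_lframe_of_unit hcm
  obtain ⟨G, -, -, hG, -⟩ := hj.exists_chart hF
  have hG' : ∀ t, c * lor (j (G (t, 0))) m = t := fun t => by
    rw [← lor_smul_right]; exact hG _
  have hfix : ∀ x, lor (j x) m ≠ 0 → s x ≠ x := by
    intro x hx h
    have := hflip x
    rw [h] at this
    exact hx (by linarith)
  have hfix' : ∀ x, lor (j x) m = 0 → s x = x := by
    intro x hx
    apply hj.injective
    rw [hs, hx]
    simp
  have hp : 0 < lor (j (G (1, 0))) m := by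
    have := hG' 1
    by_contra h
    nlinarith
  have hn : lor (j (G (-1, 0))) m < 0 := by
    have := hG' (-1)
    by_contra h
    nlinarith
  refine ⟨σ, ⟨?_, ?_, ?_⟩, fun x v => by rw [hσ]; exact hlor x v⟩
  · ext x; exact hinv x
  · intro h
    exact hfix (G (1, 0)) hp.ne' (by rw [← hσ, h]; rfl)
  · intro h
    have hcont := hj.continuous_lor m
    obtain ⟨x, hx, hx1, hx2⟩ := h {x | 0 < lor (j x) m} {x | lor (j x) m < 0}
      (isOpen_lt continuous_const hcont) (isOpen_lt hcont continuous_const)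
      (fun x hx => by
        rcases lt_trichotomy (lor (j x) m) 0 with h | h | h
        · exact Or.inr h
        · exact absurd (hfix' x h) hx
        · exact Or.inl h)
      ⟨_, hfix _ hp.ne', hp⟩ ⟨_, hfix _ hn.ne, hn⟩
    have h1 : 0 < lor (j x) m := hx1
    have h2 : lor (j x) m < 0 := hx2
    exact lt_asymm h1 h2

end HModel

lemma IsReflection.apply_apply {σ : X ≃ᵢ X} (hσ : IsReflection σ) (x : X) : σ (σ x) = x :=
  congrArg (fun f : X ≃ᵢ X => f x) hσ.1

lemma IsReflection.axiallySymmetric {σ : X ≃ᵢ X} (hσ : IsReflection σ) {S : Set X}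
    (h : ∀ x ∈ S, σ x ∈ S) : AxiallySymmetric S := by
  refine ⟨σ, hσ, Subset.antisymm ?_ fun x hx => ⟨σ x, h x hx, hσ.apply_apply x⟩⟩
  rintro _ ⟨x, hx, rfl⟩
  exact h x hx

namespace HModel

variable {j : X → ℝ × ℝ × ℝ}

lemma exists_lframe_of_point (hj : HModel j) {m : ℝ × ℝ × ℝ} {p : X} (hm : 0 < lor m m)
    (hp : lor m (j p) = 0) : ∃ n, ∃ c : ℝ, 0 < c ∧ LFrame n (c • m) (j p) := by
  obtain ⟨c, hc, hcm⟩ := exists_unit_of_spacelike hm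
  obtain ⟨n, hn⟩ := exists_lframe_of_timelike hcm (hj.norm p)
    (by rw [lor_smul_left, hp, mul_zero]) (hj.pos p)
  exact ⟨n, c, hc, hn⟩

/-- The mirror of a reflection is the zero set of a unit spacelike functional. -/
lemma exists_mirror (hj : HModel j) {σ : X ≃ᵢ X} (hσ : IsReflection σ) :
    ∃ n, lor n n = 1 ∧ ∀ x, σ x = x ↔ lor (j x) n = 0 := by
  have hperp : ∀ b x, σ x = x → lor (j x) (j b - j (σ b)) = 0 := by
    intro b x hx
    have h1 := hj.cosh_dist x b
    have h2 := hj.cosh_dist x (σ b)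
    rw [← σ.dist_eq x b, hx, h2] at h1
    rw [lor_sub_right]
    linarith
  have hspace : ∀ b, σ b ≠ b → 1 < -lor (j b) (j (σ b)) := by
    intro b hb
    rw [← hj.cosh_dist]
    exact Real.one_lt_cosh.2 (dist_pos.2 (Ne.symm hb)).ne'
  obtain ⟨a, ha⟩ : ∃ a, σ a ≠ a := by
    by_contra h
    push Not at h
    exact hσ.2.1 (by ext x; exact h x)
  have hn₀ : 0 < lor (j a - j (σ a)) (j a - j (σ a)) := by
    have := hspace a ha
    simp only [lor_sub_left, lor_sub_right, hj.norm, lor_comm (j (σ a)) (j a)]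
    linarith
  obtain ⟨c, hc, hcn⟩ := exists_unit_of_spacelike hn₀
  refine ⟨_, hcn, fun x => ⟨fun hx => by rw [lor_smul_right, hperp a x hx, mul_zero], ?_⟩⟩
  intro hx
  by_contra hx₀
  rw [lor_smul_right] at hx
  have hx' : lor (j x) (j a - j (σ a)) = 0 := by
    rcases mul_eq_zero.1 hx with h | h
    · exact absurd h hc.ne'
    · exact h
  have hx1 : lor (j x) (j x - j (σ x)) ≠ 0 := by
    have := hspace x hx₀
    rw [lor_sub_right, hj.norm]
    intro h
    linarith
  have hsub : ∀ y z, σ y = y → σ z = z → y = z := by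
    intro y z hy hz
    obtain ⟨m, d, hd, hF⟩ := hj.exists_lframe_of_point hn₀ (p := y)
      (by rw [lor_comm]; exact hperp a y hy)
    set n₁ := j x - j (σ x) with hn₁
    have h1 := hF.lor_eq (j z) n₁
    rw [hperp x z hz, lor_smul_right, hperp a z hz, lor_comm n₁ (j y), hperp x y hy] at h1
    have h2 : lor n₁ m ≠ 0 := by
      intro h2
      have h3 := hF.lor_eq (j x) n₁
      rw [h2, lor_smul_right, hx', lor_comm n₁ (j y), hperp x y hy] at h3
      exact hx1 (by linarith)
    have h3 : lor (j z) m = 0 := by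
      have : lor (j z) m * lor n₁ m = 0 := by linarith
      exact (mul_eq_zero.1 this).resolve_right h2
    have h4 := hF.lor_eq (j z) (j z)
    rw [h3, lor_smul_right, hperp a z hz, hj.norm] at h4
    have h5 := hj.lor_neg z y
    have h6 : lor (j z) (j y) = -1 := by nlinarith
    symm
    apply dist_le_zero.1
    rw [hj.dist_eq, h6]
    simp
  obtain ⟨m, q, hF⟩ := exists_lframe_of_unit hcn
  obtain ⟨G, hGc, hGs, hGn, hGm, -, hG⟩ := hj.exists_chart hF
  have hGi : Function.Injective G := by
    intro w w' h
    ext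
    · rw [← hGn w, h, hGn]
    · rw [← hGm w, h, hGm]
  apply hσ.2.2
  by_cases hfix : ∃ y, σ y = y
  · obtain ⟨y, hy⟩ := hfix
    have : {x | σ x ≠ x} = G '' {(lor (j y) (c • (j a - j (σ a))), lor (j y) m)}ᶜ := by
      rw [image_compl_eq ⟨hGi, hGs⟩, image_singleton, ← hG y]
      ext z
      simp only [mem_ofPred_eq, mem_compl_iff, mem_singleton_iff, not_iff_not]
      exact ⟨fun hz => hsub z y hz hy, fun h => h ▸ hy⟩
    rw [this]
    refine IsPreconnected.image ?_ _ hGc.continuousOn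
    exact (isConnected_compl_singleton_of_one_lt_rank (by simp; norm_num) _).isPreconnected
  · push Not at hfix
    have : {x | σ x ≠ x} = G '' univ := by
      rw [image_univ, hGs.range_eq]
      exact eq_univ_of_forall hfix
    rw [this]
    exact isPreconnected_univ.image _ hGc.continuousOn

/-- The part of the hyperbolic plane over a convex set of values is connected. -/
lemma isPreconnected_preimage (hj : HModel j) {n : ℝ × ℝ × ℝ} (hn : lor n n = 1) {I : Set ℝ}
    (hI : Convex ℝ I) : IsPreconnected {x | lor (j x) n ∈ I} := by
  obtain ⟨m, q, hF⟩ := exists_lframe_of_unit hn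
  obtain ⟨G, hGc, hGs, hGn, -⟩ := hj.exists_chart hF
  have : {x | lor (j x) n ∈ I} = G '' (I ×ˢ univ) := by
    ext x
    constructor
    · intro hx
      obtain ⟨w, rfl⟩ := hGs x
      refine ⟨w, ⟨?_, mem_univ _⟩, rfl⟩
      rw [← hGn w]; exact hx
    · rintro ⟨w, hw, rfl⟩
      rw [mem_ofPred_eq, hGn]; exact hw.1
  rw [this]
  exact (hI.prod convex_univ).isPreconnected.image _ hGc.continuousOn

lemma exists_of_isHalfspace (hj : HModel j) {P : Set X} (hP : IsHalfspace P) :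
    ∃ n, lor n n = 1 ∧ P = {x | lor (j x) n ≤ 0} := by
  obtain ⟨σ, hσ, hcl, hun, hin⟩ := hP
  obtain ⟨n, hn, hmir⟩ := hj.exists_mirror hσ
  obtain ⟨a, ha⟩ : ∃ a, σ a ≠ a := by
    by_contra h
    push Not at h
    exact hσ.2.1 (by ext x; exact h x)
  have hσcl : IsClosed (⇑σ '' P) := σ.toHomeomorph.isClosedMap _ hcl
  have hside : ∀ I : Set ℝ, Convex ℝ I → 0 ∉ I → {x | lor (j x) n ∈ I} ⊆ P ∨
      {x | lor (j x) n ∈ I} ∩ P ⊆ ∅ := by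
    intro I hI h0
    have hdis : ∀ x, lor (j x) n ∈ I → x ∈ P ∩ ⇑σ '' P → False := by
      intro x hx hxx
      rw [hin] at hxx
      rw [(hmir x).1 hxx] at hx
      exact h0 hx
    rcases isPreconnected_iff_subset_of_disjoint_closed.1 (hj.isPreconnected_preimage hn hI)
      P (⇑σ '' P) hcl hσcl (by rw [hun]; exact subset_univ _)
      (eq_empty_of_forall_notMem fun x hx => hdis x hx.1 hx.2) with h | h
    · exact Or.inl h
    · exact Or.inr fun x hx => hdis x hx.1 ⟨hx.2, h hx.1⟩
  have hzero : ∀ x, lor (j x) n = 0 → x ∈ P := fun x hx => by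
    have : x ∈ P ∩ ⇑σ '' P := by rw [hin]; exact (hmir x).2 hx
    exact this.1
  rcases hside (Ioi 0) (convex_Ioi 0) (by simp) with hp | hp <;>
    rcases hside (Iio 0) (convex_Iio 0) (by simp) with hm | hm
  · exfalso
    have hPu : P = univ := eq_univ_of_forall fun x => by
      rcases lt_trichotomy (lor (j x) n) 0 with h | h | h
      · exact hm h
      · exact hzero x h
      · exact hp h
    rw [hPu, image_univ, σ.surjective.range_eq, univ_inter] at hin
    have : a ∈ {x | σ x = x} := hin ▸ mem_univ a
    exact ha this
  · refine ⟨-n, by rw [lor_neg_left, lor_neg_right, hn, neg_neg], ?_⟩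
    ext x
    rw [mem_ofPred_eq, lor_neg_right, neg_nonpos]
    constructor
    · intro hx
      by_contra h
      exact hm ⟨not_le.1 h, hx⟩
    · intro hx
      rcases hx.eq_or_lt with h | h
      · exact hzero x h.symm
      · exact hp h
  · refine ⟨n, hn, ?_⟩
    ext x
    constructor
    · intro hx
      by_contra h
      exact hp ⟨show 0 < lor (j x) n from lt_of_not_ge h, hx⟩
    · intro (hx : lor (j x) n ≤ 0)
      rcases hx.eq_or_lt with h | h
      · exact hzero x h
      · exact hm h
  · exfalso
    have hPm : ∀ x ∈ P, σ x = x := fun x hx => by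
      rw [hmir]
      rcases lt_trichotomy (lor (j x) n) 0 with h | h | h
      · exact (hm ⟨h, hx⟩).elim
      · exact h
      · exact (hp ⟨h, hx⟩).elim
    have : a ∈ P ∪ ⇑σ '' P := hun ▸ mem_univ a
    rcases this with h | ⟨b, hb, hba⟩
    · exact ha (hPm a h)
    · rw [hPm b hb] at hba
      exact ha (hPm a (hba ▸ hb))

/-- The signed distance to a line is `1`-Lipschitz. -/
lemma abs_arsinh_sub_le_dist (hj : HModel j) {n : ℝ × ℝ × ℝ} (hn : lor n n = 1) (x y : X) :
    |Real.arsinh (lor (j x) n) - Real.arsinh (lor (j y) n)| ≤ dist x y := by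
  obtain ⟨m, q, hF⟩ := exists_lframe_of_unit hn
  obtain ⟨G, -, hGs, hGn, hGm, hGq, -⟩ := hj.exists_chart hF
  obtain ⟨⟨s, b⟩, rfl⟩ := hGs x
  obtain ⟨⟨t, d⟩, rfl⟩ := hGs y
  rw [← abs_of_nonneg (dist_nonneg (x := G (s, b))), ← Real.cosh_le_cosh, hj.cosh_dist,
    hF.lor_eq (j (G (s, b))) (j (G (t, d)))]
  simp only [hGn, hGm, hGq]
  rw [Real.cosh_sub, Real.cosh_arsinh, Real.cosh_arsinh, Real.sinh_arsinh, Real.sinh_arsinh]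
  have h1 : Real.sqrt (1 + s ^ 2) * Real.sqrt (1 + t ^ 2) + b * d ≤
      Real.sqrt (1 + s ^ 2 + b ^ 2) * Real.sqrt (1 + t ^ 2 + d ^ 2) := by
    rw [← Real.sqrt_mul (by positivity : (0 : ℝ) ≤ 1 + s ^ 2 + b ^ 2)]
    apply Real.le_sqrt_of_sq_le
    have h2 := Real.mul_self_sqrt (by positivity : (0 : ℝ) ≤ 1 + s ^ 2)
    have h3 := Real.mul_self_sqrt (by positivity : (0 : ℝ) ≤ 1 + t ^ 2)
    set A := Real.sqrt (1 + s ^ 2)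
    set C := Real.sqrt (1 + t ^ 2)
    rw [← h2, ← h3]
    nlinarith [sq_nonneg (A * d - C * b)]
  linarith

lemma exists_dist_eq (hj : HModel j) {n : ℝ × ℝ × ℝ} (hn : lor n n = 1) (x : X) (t : ℝ) :
    ∃ y, lor (j y) n = t ∧ dist x y = |Real.arsinh (lor (j x) n) - Real.arsinh t| := by
  obtain ⟨m, q, hF⟩ := exists_lframe_of_unit hn
  obtain ⟨G, -, hGs, hGn, hGm, hGq, -⟩ := hj.exists_chart hF
  obtain ⟨⟨s, b⟩, rfl⟩ := hGs x
  have h2 := Real.mul_self_sqrt (by positivity : (0 : ℝ) ≤ 1 + s ^ 2)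
  have h3 := Real.mul_self_sqrt (by positivity : (0 : ℝ) ≤ 1 + t ^ 2)
  have hA : 0 < Real.sqrt (1 + s ^ 2) := Real.sqrt_pos.2 (by positivity)
  have hC : 0 < Real.sqrt (1 + t ^ 2) := Real.sqrt_pos.2 (by positivity)
  refine ⟨G (t, b * (Real.sqrt (1 + t ^ 2) / Real.sqrt (1 + s ^ 2))), hGn _, ?_⟩
  rw [← abs_of_nonneg (dist_nonneg (x := G (s, b)))]
  suffices h : Real.cosh (dist (G (s, b))
      (G (t, b * (Real.sqrt (1 + t ^ 2) / Real.sqrt (1 + s ^ 2))))) =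
      Real.cosh (Real.arsinh (lor (j (G (s, b))) n) - Real.arsinh t) from
    le_antisymm (Real.cosh_le_cosh.1 h.le) (Real.cosh_le_cosh.1 h.ge)
  rw [hj.cosh_dist, hF.lor_eq (j (G (s, b)))]
  simp only [hGn, hGm, hGq]
  rw [Real.cosh_sub, Real.cosh_arsinh, Real.cosh_arsinh, Real.sinh_arsinh, Real.sinh_arsinh]
  set A := Real.sqrt (1 + s ^ 2)
  set C := Real.sqrt (1 + t ^ 2)
  have h4 : 1 + t ^ 2 + (b * (C / A)) ^ 2 = (C / A) ^ 2 * (1 + s ^ 2 + b ^ 2) := by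
    rw [← h2, ← h3]; field_simp
  rw [h4, Real.sqrt_mul (by positivity), Real.sqrt_sq (by positivity)]
  have h5 := Real.mul_self_sqrt (by positivity : (0 : ℝ) ≤ 1 + s ^ 2 + b ^ 2)
  set D := Real.sqrt (1 + s ^ 2 + b ^ 2)
  have h6 : D * D = A * A + b ^ 2 := by rw [h5, h2]
  have h7 : C / A * (A * A) = A * C := by field_simp
  linear_combination C / A * h6 + h7

lemma setOf_infDist_halfspace_le (hj : HModel j) {n : ℝ × ℝ × ℝ} (hn : lor n n = 1) {l : ℝ}
    (hl : 0 ≤ l) :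
    {x | infDist x {x | lor (j x) n ≤ 0} ≤ l} = {x | lor (j x) n ≤ Real.sinh l} := by
  ext x
  simp only [mem_ofPred_eq]
  obtain ⟨y, hy, hxy⟩ := hj.exists_dist_eq hn x 0
  rw [Real.arsinh_zero, sub_zero] at hxy
  have hsl : Real.arsinh (lor (j x) n) ≤ l ↔ lor (j x) n ≤ Real.sinh l := by
    rw [← Real.sinh_le_sinh, Real.sinh_arsinh]
  rw [← hsl]
  constructor
  · refine fun h => le_trans ((le_infDist (⟨y, hy.le⟩ : Set.Nonempty _)).2 fun z hz => ?_) h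
    have h1 := (le_abs_self _).trans (hj.abs_arsinh_sub_le_dist hn x z)
    have h2 : Real.arsinh (lor (j z) n) ≤ 0 := Real.arsinh_nonpos_iff.2 hz
    linarith
  · intro h
    by_cases hx : lor (j x) n ≤ 0
    · rw [infDist_zero_of_mem (s := {x | lor (j x) n ≤ 0}) hx]; exact hl
    · refine (infDist_le_dist_of_mem (y := y) hy.le).trans ?_
      rw [hxy, abs_of_nonneg (Real.arsinh_nonneg_iff.2 (not_le.1 hx).le)]
      exact h

lemma setOf_infDist_line_le (hj : HModel j) {n : ℝ × ℝ × ℝ} (hn : lor n n = 1) (l : ℝ) :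
    {x | infDist x {x | lor (j x) n = 0} ≤ l} = {x | |lor (j x) n| ≤ Real.sinh l} := by
  ext x
  simp only [mem_ofPred_eq]
  obtain ⟨y, hy, hxy⟩ := hj.exists_dist_eq hn x 0
  rw [Real.arsinh_zero, sub_zero] at hxy
  have hsl : |Real.arsinh (lor (j x) n)| ≤ l ↔ |lor (j x) n| ≤ Real.sinh l := by
    rw [abs_le, abs_le, ← Real.sinh_neg, ← Real.sinh_le_sinh, ← Real.sinh_le_sinh (y := l),
      Real.sinh_arsinh]
  rw [← hsl]
  constructor
  · refine fun h => le_trans ((le_infDist (⟨y, hy⟩ : Set.Nonempty _)).2 fun z hz => ?_) h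
    have h1 := hj.abs_arsinh_sub_le_dist hn x z
    rw [show lor (j z) n = 0 from hz, Real.arsinh_zero, sub_zero] at h1
    exact h1
  · intro h
    refine (infDist_le_dist_of_mem (y := y) hy).trans ?_
    rw [hxy]
    exact h

lemma frontier_setOf_le (hj : HModel j) {n : ℝ × ℝ × ℝ} (hn : lor n n = 1) (c : ℝ) :
    frontier {x | lor (j x) n ≤ c} = {x | lor (j x) n = c} := by
  apply Subset.antisymm (frontier_le_subset_eq (hj.continuous_lor n) continuous_const)
  intro x hx
  refine ⟨subset_closure (le_of_eq hx), fun hint => ?_⟩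
  obtain ⟨m, q, hF⟩ := exists_lframe_of_unit hn
  obtain ⟨G, hGc, hGs, hGn, -⟩ := hj.exists_chart hF
  obtain ⟨⟨s, b⟩, rfl⟩ := hGs x
  rw [mem_ofPred_eq, hGn] at hx
  have hc : Continuous fun t : ℝ => G (t, b) := by fun_prop
  have h1 := hc.continuousAt.eventually (mem_interior_iff_mem_nhds.1 hint)
  have h2 : ∀ᶠ t in nhds s, t ≤ c := h1.mono fun t ht => by
    have : lor (j (G (t, b))) n ≤ c := ht
    rwa [hGn] at this
  obtain ⟨ε, hε, h3⟩ := Metric.eventually_nhds_iff.1 h2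
  have := h3 (y := s + ε / 2) (by rw [Real.dist_eq]; rw [abs_of_pos] <;> linarith)
  simp only at hx
  linarith

/-- Parametrization of geodesics in the model. -/
lemma exists_geodesic (hj : HModel j) {γ : ℝ → X} (hγ : Isometry γ) :
    ∃ m q, lor m m = 1 ∧ lor q q = -1 ∧ lor m q = 0 ∧ 0 < q.2.2 ∧
      ∀ t, j (γ t) = Real.cosh t • q + Real.sinh t • m := by
  have hd : ∀ s t, lor (j (γ s)) (j (γ t)) = -Real.cosh (s - t) := by
    intro s t
    have := hj.cosh_dist (γ s) (γ t)
    rw [hγ.dist_eq, Real.dist_eq, Real.cosh_abs] at this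
    linarith
  have hs1 : 0 < Real.sinh 1 := Real.sinh_pos_iff.2 one_pos
  have hcs : Real.cosh 1 ^ 2 - Real.sinh 1 ^ 2 = 1 := Real.cosh_sq_sub_sinh_sq 1
  set m : ℝ × ℝ × ℝ := (Real.sinh 1)⁻¹ • (j (γ 1) - Real.cosh 1 • j (γ 0)) with hm
  have hmq : lor m (j (γ 0)) = 0 := by
    rw [hm, lor_smul_left, lor_sub_left, lor_smul_left, hd, hd]
    simp
  have hγm : ∀ t, lor (j (γ t)) m = Real.sinh t := by
    intro t
    rw [hm, lor_smul_right, lor_sub_right, lor_smul_right, hd, hd, sub_zero, Real.cosh_sub]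
    field_simp
    ring
  have hmm : lor m m = 1 := by
    conv_lhs => rw [hm]
    rw [lor_smul_left, lor_sub_left, lor_smul_left, lor_comm (j (γ 0)), hmq, hγm]
    field_simp
    ring
  refine ⟨m, j (γ 0), hmm, hj.norm _, hmq, hj.pos _, fun t => ?_⟩
  obtain ⟨n, hF⟩ := exists_lframe_of_timelike hmm (hj.norm (γ 0)) hmq (hj.pos _)
  have h1 := hF.lor_eq (j (γ t)) (j (γ t))
  have h2 := hF.expand (j (γ t))
  have h3 := Real.cosh_sq_sub_sinh_sq t
  rw [hj.norm, hγm, hd, sub_zero] at h1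
  have h4 : lor (j (γ t)) n = 0 := by
    have : lor (j (γ t)) n ^ 2 = 0 := by linarith
    exact pow_eq_zero_iff two_ne_zero |>.1 this
  rw [h4, hγm, hd, sub_zero] at h2
  rw [h2]
  simp only [zero_smul, zero_add, neg_smul, sub_neg_eq_add]
  exact add_comm _ _

lemma exists_of_isGeodesicLine (hj : HModel j) {B : Set X} (hB : IsGeodesicLine B) :
    ∃ n, lor n n = 1 ∧ B = {x | lor (j x) n = 0} := by
  obtain ⟨γ, hγ, rfl⟩ := hB
  obtain ⟨m, q, hm, hq, hmq, hpos, hjγ⟩ := hj.exists_geodesic hγ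
  obtain ⟨n, hF⟩ := exists_lframe_of_timelike hm hq hmq hpos
  refine ⟨n, hF.nn, ?_⟩
  ext x
  constructor
  · rintro ⟨t, rfl⟩
    rw [mem_ofPred_eq, hjγ, lor_add_left, lor_smul_left, lor_smul_left, lor_comm q, lor_comm m,
      hF.nq, hF.nm]
    simp
  · intro (hx : lor (j x) n = 0)
    refine ⟨Real.arsinh (lor (j x) m), hj.injective ?_⟩
    have h1 := hF.lor_eq (j x) (j x)
    have h2 := hF.expand (j x)
    rw [hx, zero_smul, zero_add] at h2
    rw [hj.norm, hx] at h1
    obtain ⟨p, hp⟩ := hj.surj q hq hpos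
    have h3 : Real.sqrt (1 + lor (j x) m ^ 2) = -lor (j x) q := by
      rw [Real.sqrt_eq_iff_mul_self_eq (by positivity)]
      · linarith
      · rw [← hp]; linarith [hj.lor_neg x p]
    rw [hjγ, Real.cosh_arsinh, Real.sinh_arsinh, h3, neg_smul, neg_add_eq_sub]
    exact h2.symm

lemma exists_of_isParaball (hj : HModel j) {K : Set X} (hK : IsParaball K) :
    ∃ v, lor v v = 0 ∧ K = {x | lor (j x) v ≤ 1} := by
  obtain ⟨γ, hγ, rfl⟩ := hK
  obtain ⟨m, q, hm, hq, hmq, -, hjγ⟩ := hj.exists_geodesic hγ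
  refine ⟨-(q + m), ?_, ?_⟩
  · rw [lor_neg_left, lor_neg_right, lor_add_left, lor_add_right, lor_add_right, hm, hq, hmq,
      lor_comm q, hmq]
    norm_num
  ext x
  set L := lor (j x) (-(q + m)) with hL
  have hexp0 : Tendsto (fun t : ℝ => Real.exp (-(2 * t))) atTop (nhds 0) :=
    Real.tendsto_exp_neg_atTop_nhds_zero.comp (tendsto_id.const_mul_atTop two_pos)
  have hcosh : ∀ t, Real.exp (dist x (γ t) - t) =
      -((1 + Real.exp (-(2 * t))) * lor (j x) q + (1 - Real.exp (-(2 * t))) * lor (j x) m) -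
        Real.exp (-(dist x (γ t) - t)) * Real.exp (-(2 * t)) := by
    intro t
    have h1 := hj.cosh_dist x (γ t)
    rw [hjγ, lor_add_right, lor_smul_right, lor_smul_right, Real.cosh_eq, Real.cosh_eq,
      Real.sinh_eq] at h1
    have e1 : Real.exp (dist x (γ t) - t) = Real.exp (dist x (γ t)) * Real.exp (-t) := by
      rw [← Real.exp_add]; ring_nf
    have e2 : Real.exp (-(2 * t)) = Real.exp (-t) * Real.exp (-t) := by
      rw [← Real.exp_add]; ring_nf
    have e3 : Real.exp (-(dist x (γ t) - t)) = Real.exp (-dist x (γ t)) * Real.exp t := by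
      rw [← Real.exp_add]; ring_nf
    have e4 : Real.exp t * Real.exp (-t) = 1 := by
      rw [← Real.exp_add]; simp
    rw [e1, e2, e3]
    linear_combination (2 * Real.exp (-t)) * h1 +
      (-lor (j x) q - lor (j x) m + Real.exp (-dist x (γ t)) * Real.exp (-t)) * e4
  have hbound : ∀ t, 0 ≤ t → -dist x (γ 0) ≤ dist x (γ t) - t := by
    intro t ht
    have h1 := dist_triangle_left (γ 0) (γ t) x
    rw [hγ.dist_eq, Real.dist_eq, zero_sub, abs_neg, abs_of_nonneg ht] at h1
    linarith
  have hsmall : Tendsto (fun t => Real.exp (-(dist x (γ t) - t)) * Real.exp (-(2 * t))) atTop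
      (nhds 0) := by
    have h1 : Tendsto (fun t => Real.exp (dist x (γ 0)) * Real.exp (-(2 * t))) atTop (nhds 0) := by
      simpa using hexp0.const_mul (Real.exp (dist x (γ 0)))
    refine squeeze_zero' (Eventually.of_forall fun t => by positivity) ?_ h1
    filter_upwards [eventually_ge_atTop 0] with t ht
    refine mul_le_mul_of_nonneg_right (Real.exp_le_exp.2 ?_) (by positivity)
    linarith [hbound t ht]
  have hlim : Tendsto (fun t => Real.exp (dist x (γ t) - t)) atTop (nhds L) := by
    have h1 : Tendsto (fun t => -((1 + Real.exp (-(2 * t))) * lor (j x) q +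
        (1 - Real.exp (-(2 * t))) * lor (j x) m) -
        Real.exp (-(dist x (γ t) - t)) * Real.exp (-(2 * t))) atTop
        (nhds (-((1 + 0) * lor (j x) q + (1 - 0) * lor (j x) m) - 0)) :=
      ((((hexp0.const_add 1).mul_const _).add ((hexp0.const_sub 1).mul_const _)).neg).sub hsmall
    have h2 : -((1 + 0) * lor (j x) q + (1 - 0) * lor (j x) m) - 0 = L := by
      rw [hL, lor_neg_right, lor_add_right]; ring
    rw [h2] at h1
    exact h1.congr fun t => (hcosh t).symm
  have hLpos : 0 < L := by
    refine (Real.exp_pos (-dist x (γ 0))).trans_le (ge_of_tendsto hlim ?_)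
    filter_upwards [eventually_ge_atTop 0] with t ht
    exact Real.exp_le_exp.2 (hbound t ht)
  have hlog : Tendsto (fun t => dist x (γ t) - t) atTop (nhds (Real.log L)) := by
    have := hlim.log hLpos.ne'
    simpa using this
  simp only [mem_ofPred_eq]
  constructor
  · rintro ⟨b, hb, hlb⟩
    rw [tendsto_nhds_unique hlb hlog, Real.log_nonpos_iff hLpos.le] at hb
    exact hb
  · intro h
    exact ⟨_, (Real.log_nonpos_iff hLpos.le).2 h, hlog⟩

end HModel

/-- A sublevel set of the linear functional given by a vector of norm `k`. -/
def IsLorBody (j : X → ℝ × ℝ × ℝ) (k c : ℝ) (S : Set X) : Prop :=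
  ∃ v, lor v v = k ∧ S = {x | lor (j x) v ≤ c}

/-- A strip symmetric about the zero set of a unit spacelike functional. -/
def IsLorStrip (j : X → ℝ × ℝ × ℝ) (c : ℝ) (S : Set X) : Prop :=
  ∃ v, lor v v = 1 ∧ S = {x | |lor (j x) v| ≤ c}

namespace HModel

variable {j : X → ℝ × ℝ × ℝ} {k k' c c' : ℝ} {S T : Set X}

lemma isLorBody_image (hj : HModel j) (g : X ≃ᵢ X) (h : IsLorBody j k c S) :
    IsLorBody j k c (⇑g '' S) := by
  obtain ⟨v, hv, rfl⟩ := h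
  obtain ⟨w, hw, hg⟩ := hj.exists_adjoint g.symm v
  refine ⟨w, hw.trans hv, ?_⟩
  ext x
  constructor
  · rintro ⟨y, hy, rfl⟩
    rw [mem_ofPred_eq, ← hg, g.symm_apply_apply]
    exact hy
  · intro hx
    refine ⟨g.symm x, ?_, g.apply_symm_apply x⟩
    rw [mem_ofPred_eq, hg]
    exact hx

lemma isLorStrip_image (hj : HModel j) (g : X ≃ᵢ X) (h : IsLorStrip j c S) :
    IsLorStrip j c (⇑g '' S) := by
  obtain ⟨v, hv, rfl⟩ := h
  obtain ⟨w, hw, hg⟩ := hj.exists_adjoint g.symm v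
  refine ⟨w, hw.trans hv, ?_⟩
  ext x
  constructor
  · rintro ⟨y, hy, rfl⟩
    rw [mem_ofPred_eq, ← hg, g.symm_apply_apply]
    exact hy
  · intro hx
    refine ⟨g.symm x, ?_, g.apply_symm_apply x⟩
    rw [mem_ofPred_eq, hg]
    exact hx

lemma exists_reflection_fixing (hj : HModel j) {m : ℝ × ℝ × ℝ} (hm : 0 < lor m m) :
    ∃ σ : X ≃ᵢ X, IsReflection σ ∧ (∀ x, lor (j (σ x)) m = -lor (j x) m) ∧
      ∀ v, lor m v = 0 → ∀ x, lor (j (σ x)) v = lor (j x) v := by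
  obtain ⟨σ, hσ, h⟩ := hj.exists_reflection hm
  refine ⟨σ, hσ, fun x => ?_, fun v hv x => ?_⟩
  · rw [h, lor_sub_right, lor_smul_right]
    field_simp
    ring
  · rw [h, lor_comm v, hv]
    simp

lemma exists_reflection_swapping (hj : HModel j) {u v : ℝ × ℝ × ℝ} (huv : lor u u = lor v v)
    (h : lor u v < lor u u) :
    ∃ σ : X ≃ᵢ X, IsReflection σ ∧ ∀ x, lor (j (σ x)) u = lor (j x) v ∧
      lor (j (σ x)) v = lor (j x) u := by
  have hm : lor (u - v) (u - v) = 2 * (lor u u - lor u v) := by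
    rw [lor_sub_left, lor_sub_right, lor_sub_right, lor_comm v u, ← huv]; ring
  have hpos : 0 < lor (u - v) (u - v) := by rw [hm]; linarith
  obtain ⟨σ, hσ, hr⟩ := hj.exists_reflection hpos
  have h0 : lor u u - lor u v ≠ 0 := by linarith
  refine ⟨σ, hσ, fun x => ⟨?_, ?_⟩⟩
  · rw [hr, hm, lor_sub_right u, div_self (by simpa using h0), one_smul, sub_sub_cancel]
  · rw [hr, hm, lor_sub_right v, lor_comm v u, ← huv,
      show 2 * (lor u v - lor u u) = -(2 * (lor u u - lor u v)) by ring, neg_div,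
      div_self (by simpa using h0), neg_smul, one_smul, sub_neg_eq_add, add_sub_cancel]

lemma axiallySymmetric_inter_of_perp (hj : HModel j) {m v w : ℝ × ℝ × ℝ} (hm : 0 < lor m m)
    (hv : lor m v = 0) (hw : lor m w = 0) :
    AxiallySymmetric ({x | lor (j x) v ≤ c} ∩ {x | lor (j x) w ≤ c'}) := by
  obtain ⟨σ, hσ, -, h⟩ := hj.exists_reflection_fixing hm
  refine hσ.axiallySymmetric fun x hx => ?_
  rw [mem_inter_iff, mem_ofPred_eq, mem_ofPred_eq, h v hv, h w hw]
  exact hx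

lemma axiallySymmetric_inter_of_causal (hj : HModel j) (hS : IsLorBody j k c S)
    (hT : IsLorBody j k' c' T) (h : k < 0 ∨ (k ≤ 0 ∧ k' ≤ 0)) : AxiallySymmetric (S ∩ T) := by
  obtain ⟨v, rfl, rfl⟩ := hS
  obtain ⟨w, rfl, rfl⟩ := hT
  obtain ⟨m, hm, hv, hw⟩ := exists_spacelike_perp_of_causal h
  exact hj.axiallySymmetric_inter_of_perp hm hv hw

lemma lor_sign_of_null (hj : HModel j) {d : ℝ × ℝ × ℝ} (hd : lor d d = 0) :
    (∀ x, lor (j x) d ≤ 0) ∨ ∀ x, 0 ≤ lor (j x) d := by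
  have hnorm : ∀ x, lor (j x) (j x) < 0 := fun x => by rw [hj.norm]; norm_num
  rcases lt_trichotomy d.2.2 0 with h | h | h
  · right
    intro x
    have := lor_neg_of_pos (u := -d) (by rw [lor_neg_left, lor_neg_right, hd]; simp) (hnorm x)
      (by simpa using h) (hj.pos x)
    rw [lor_neg_left, lor_comm] at this
    linarith
  · left
    intro x
    have h1 : d.1 = 0 ∧ d.2.1 = 0 := by
      simp only [lor, h] at hd
      constructor <;> nlinarith [sq_nonneg d.1, sq_nonneg d.2.1]
    simp [lor, h, h1.1, h1.2]
  · left
    intro x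
    have := lor_neg_of_pos hd.le (hnorm x) h (hj.pos x)
    rw [lor_comm] at this
    exact this.le

lemma axiallySymmetric_inter_of_spacelike (hj : HModel j) (hS : IsLorBody j 1 c S)
    (hT : IsLorBody j 1 c T) : AxiallySymmetric (S ∩ T) := by
  obtain ⟨u, hu, rfl⟩ := hS
  obtain ⟨v, hv, rfl⟩ := hT
  rcases lt_trichotomy (lor u v) 1 with h | h | h
  · obtain ⟨σ, hσ, hs⟩ := hj.exists_reflection_swapping (hu.trans hv.symm) (by rwa [hu])
    refine hσ.axiallySymmetric fun x hx => ?_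
    rw [mem_inter_iff, mem_ofPred_eq, mem_ofPred_eq, (hs x).1, (hs x).2]
    exact hx.symm
  · have hd : lor (u - v) (u - v) = 0 := by
      rw [lor_sub_left, lor_sub_right, lor_sub_right, lor_comm v u, hu, hv, h]; ring
    rcases hj.lor_sign_of_null hd with hs | hs
    · obtain ⟨m, hm, hmv⟩ := exists_spacelike_perp v
      have := hj.axiallySymmetric_inter_of_perp (c := c) (c' := c) hm hmv hmv
      rw [inter_self] at this
      rw [inter_eq_right.2]
      · exact this
      · intro x (hx : lor (j x) v ≤ c)
        have h1 := hs x
        rw [lor_sub_right] at h1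
        show lor (j x) u ≤ c
        linarith
    · obtain ⟨m, hm, hmu⟩ := exists_spacelike_perp u
      have := hj.axiallySymmetric_inter_of_perp (c := c) (c' := c) hm hmu hmu
      rw [inter_self] at this
      rw [inter_eq_left.2]
      · exact this
      · intro x (hx : lor (j x) u ≤ c)
        have h1 := hs x
        rw [lor_sub_right] at h1
        show lor (j x) v ≤ c
        linarith
  · exact hj.axiallySymmetric_inter_of_perp (m := lcross u v)
      (by rw [lor_lcross_self, hu, hv]; nlinarith) (lor_lcross_left u v) (lor_lcross_right u v)

lemma axiallySymmetric_inter_of_null_strip (hj : HModel j) (hS : IsLorBody j 0 c S)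
    (hT : IsLorStrip j c' T) : AxiallySymmetric (S ∩ T) := by
  obtain ⟨v, hv, rfl⟩ := hS
  obtain ⟨n, hn, rfl⟩ := hT
  by_cases h : lor v n = 0
  · obtain ⟨σ, hσ, hneg, hs⟩ := hj.exists_reflection_fixing (m := n) (by rw [hn]; exact one_pos)
    refine hσ.axiallySymmetric fun x hx => ?_
    rw [mem_inter_iff, mem_ofPred_eq, mem_ofPred_eq, hneg, abs_neg,
      hs v (by rw [lor_comm, h])]
    exact hx
  · obtain ⟨σ, hσ, -, hs⟩ := hj.exists_reflection_fixing (m := lcross v n)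
      (by rw [lor_lcross_self, hv, hn]; have := pow_pos (abs_pos.2 h) 2; rw [sq_abs] at this; linarith)
    refine hσ.axiallySymmetric fun x hx => ?_
    rw [mem_inter_iff, mem_ofPred_eq, mem_ofPred_eq, hs v (lor_lcross_left v n),
      hs n (lor_lcross_right v n)]
    exact hx

lemma axiallySymmetric_inter_of_strips (hj : HModel j) (hS : IsLorStrip j c S)
    (hT : IsLorStrip j c T) : AxiallySymmetric (S ∩ T) := by
  obtain ⟨u, hu, rfl⟩ := hS
  obtain ⟨v, hv, rfl⟩ := hT
  obtain ⟨w, hw, hvw, h⟩ : ∃ w, lor w w = 1 ∧ (∀ x, |lor (j x) v| = |lor (j x) w|) ∧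
      lor u w ≤ 0 := by
    rcases le_total (lor u v) 0 with h | h
    · exact ⟨v, hv, fun _ => rfl, h⟩
    · refine ⟨-v, by rw [lor_neg_left, lor_neg_right, hv, neg_neg], fun x => ?_, ?_⟩
      · rw [lor_neg_right, abs_neg]
      · rw [lor_neg_right]; linarith
  simp only [hvw]
  obtain ⟨σ, hσ, hs⟩ := hj.exists_reflection_swapping (hu.trans hw.symm) (by linarith)
  refine hσ.axiallySymmetric fun x hx => ?_
  rw [mem_inter_iff, mem_ofPred_eq, mem_ofPred_eq, (hs x).1, (hs x).2]
  exact hx.symm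

lemma closedBall_eq (hj : HModel j) (p : X) {r : ℝ} (hr : 0 ≤ r) :
    closedBall p r = {x | lor (j x) (-j p) ≤ Real.cosh r} := by
  ext x
  rw [mem_closedBall, hj.dist_le_iff x p hr, mem_ofPred_eq, lor_neg_right]

lemma isLorBody_of_isDisc (hj : HModel j) (hS : IsDisc S) : ∃ c, IsLorBody j (-1) c S := by
  obtain ⟨p, r, hr, rfl⟩ := hS
  exact ⟨Real.cosh r, -j p, by rw [lor_neg_left, lor_neg_right, hj.norm, neg_neg],
    hj.closedBall_eq p hr.le⟩

lemma isLorBody_of_isParaball (hj : HModel j) (hS : IsParaball S) : IsLorBody j 0 1 S :=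
  hj.exists_of_isParaball hS

lemma isLorBody_of_hypercycleDomain_or_halfspace (hj : HModel j)
    (hS : IsHypercycleDomain S ∨ IsHalfspace S) : ∃ c, IsLorBody j 1 c S := by
  rcases hS with ⟨P, l, hP, hl, rfl⟩ | hS
  · obtain ⟨n, hn, rfl⟩ := hj.exists_of_isHalfspace hP
    exact ⟨Real.sinh l, n, hn, hj.setOf_infDist_halfspace_le hn hl.le⟩
  · exact ⟨0, hj.exists_of_isHalfspace hS⟩

lemma isLorStrip_of_isParallelDomain (hj : HModel j) (hS : IsParallelDomain S) :
    ∃ c, IsLorStrip j c S := by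
  obtain ⟨B, l, hB, -, rfl⟩ := hS
  obtain ⟨n, hn, rfl⟩ := hj.exists_of_isGeodesicLine hB
  exact ⟨Real.sinh l, n, hn, hj.setOf_infDist_line_le hn l⟩

lemma axiallySymmetric_of_caseA (hj : HModel j) {K L : Set X} (h : CaseA K L) (φ ψ : X ≃ᵢ X) :
    AxiallySymmetric (⇑φ '' K ∩ ⇑ψ '' L) := by
  obtain ⟨hK, hL, hKL, hLK⟩ := h
  have hdisc : ∀ {A B : Set X} (f g : X ≃ᵢ X), IsDisc A → CaseABody B →
      AxiallySymmetric (⇑f '' A ∩ ⇑g '' B) := by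
    intro A B f g hA hB
    obtain ⟨c, hA⟩ := hj.isLorBody_of_isDisc hA
    have hA := hj.isLorBody_image f hA
    have key : ∀ {k c'}, IsLorBody j k c' B → AxiallySymmetric (⇑f '' A ∩ ⇑g '' B) :=
      fun hB => hj.axiallySymmetric_inter_of_causal hA (hj.isLorBody_image g hB)
        (Or.inl (by norm_num))
    rcases hB with hB | hB | hB
    · exact key (hj.isLorBody_of_isDisc hB).choose_spec
    · exact key (hj.isLorBody_of_isParaball hB)
    · exact key (hj.isLorBody_of_hypercycleDomain_or_halfspace hB).choose_spec
  have hspace : ∀ {A B : Set X} (f g : X ≃ᵢ X), (IsHypercycleDomain A ∨ IsHalfspace A) →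
      Congruent A B → AxiallySymmetric (⇑f '' A ∩ ⇑g '' B) := by
    rintro A _ f g hA ⟨i, rfl⟩
    obtain ⟨c, hA⟩ := hj.isLorBody_of_hypercycleDomain_or_halfspace hA
    exact hj.axiallySymmetric_inter_of_spacelike (hj.isLorBody_image f hA)
      (hj.isLorBody_image g (hj.isLorBody_image i hA))
  rcases id hK with hK' | hK' | hK'
  · exact hdisc φ ψ hK' hL
  · rcases id hL with hL' | hL' | hL'
    · rw [inter_comm]
      exact hdisc ψ φ hL' hK
    · exact hj.axiallySymmetric_inter_of_causal
        (hj.isLorBody_image φ (hj.isLorBody_of_isParaball hK'))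
        (hj.isLorBody_image ψ (hj.isLorBody_of_isParaball hL')) (Or.inr ⟨le_rfl, le_rfl⟩)
    · rcases hLK hL' with h | h
      · exact hdisc φ ψ h hL
      · rw [inter_comm]
        exact hspace ψ φ hL' h
  · rcases hKL hK' with h | h
    · rw [inter_comm]
      exact hdisc ψ φ h hK
    · exact hspace φ ψ hK' h

lemma axiallySymmetric_of_caseD (hj : HModel j) {K L : Set X} (h : CaseD K L) (φ ψ : X ≃ᵢ X) :
    AxiallySymmetric (⇑φ '' K ∩ ⇑ψ '' L) := by
  rcases h with ⟨h1, h2⟩ | ⟨h1, h2⟩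
  · obtain ⟨c, h2⟩ := hj.isLorStrip_of_isParallelDomain h2
    exact hj.axiallySymmetric_inter_of_null_strip
      (hj.isLorBody_image φ (hj.isLorBody_of_isParaball h1)) (hj.isLorStrip_image ψ h2)
  · obtain ⟨c, h2⟩ := hj.isLorStrip_of_isParallelDomain h2
    rw [inter_comm]
    exact hj.axiallySymmetric_inter_of_null_strip
      (hj.isLorBody_image ψ (hj.isLorBody_of_isParaball h1)) (hj.isLorStrip_image φ h2)

lemma axiallySymmetric_of_caseE (hj : HModel j) {K L : Set X} (h : CaseE K L) (φ ψ : X ≃ᵢ X) :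
    AxiallySymmetric (⇑φ '' K ∩ ⇑ψ '' L) := by
  obtain ⟨⟨f, rfl⟩, hK, -⟩ := h
  obtain ⟨c, hK⟩ := hj.isLorStrip_of_isParallelDomain hK
  exact hj.axiallySymmetric_inter_of_strips (hj.isLorStrip_image φ hK)
    (hj.isLorStrip_image ψ (hj.isLorStrip_image f hK))

end HModel

lemma subset_of_disjoint_frontier {S M : Set X} (hS : IsPreconnected S)
    (h : ∀ z ∈ S, z ∉ frontier M) {x : X} (hxS : x ∈ S) (hxM : x ∈ M) : S ⊆ M := by
  have hint : ∀ z ∈ S, z ∈ closure M → z ∈ interior M := fun z hz hzM => by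
    by_contra hz'
    exact h z hz ⟨hzM, hz'⟩
  refine (hS.subset_left_of_subset_union isOpen_interior
    (isClosed_closure (s := M)).isOpen_compl ?_ ?_
    ⟨x, hxS, hint x hxS (subset_closure hxM)⟩).trans interior_subset
  · exact disjoint_left.2 fun z hz hz' => hz' (subset_closure (interior_subset hz))
  · intro z hz
    by_cases hzM : z ∈ closure M
    · exact Or.inl (hint z hz hzM)
    · exact Or.inr hzM

lemma IsReflection.conj {σ : X ≃ᵢ X} (hσ : IsReflection σ) (g : X ≃ᵢ X) :
    IsReflection (g.symm.trans (σ.trans g)) := by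
  have happ : ∀ x, (g.symm.trans (σ.trans g)) x = g (σ (g.symm x)) := fun _ => rfl
  refine ⟨?_, ?_, ?_⟩
  · ext x
    show g (σ (g.symm (g (σ (g.symm x))))) = x
    rw [g.symm_apply_apply, hσ.apply_apply, g.apply_symm_apply]
  · intro h
    apply hσ.2.1
    ext x
    have h1 := congrArg (fun f : X ≃ᵢ X => f (g x)) h
    simp only [happ, g.symm_apply_apply] at h1
    exact g.injective h1
  · intro h
    apply hσ.2.2
    have h1 : {x | (g.symm.trans (σ.trans g)) x ≠ x} = g.toHomeomorph '' {x | σ x ≠ x} := by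
      ext x
      constructor
      · intro hx
        refine ⟨g.symm x, fun h => hx ?_, g.apply_symm_apply x⟩
        rw [happ, h, g.apply_symm_apply]
      · rintro ⟨y, hy, rfl⟩ h
        apply hy
        change g (σ (g.symm (g y))) = g y at h
        rw [g.symm_apply_apply] at h
        exact g.injective h
    rw [h1] at h
    exact g.toHomeomorph.isPreconnected_image.1 h

lemma AxiallySymmetric.image {S : Set X} (hS : AxiallySymmetric S) (g : X ≃ᵢ X) :
    AxiallySymmetric (⇑g '' S) := by
  obtain ⟨σ, hσ, h⟩ := hS
  have hmem : ∀ x ∈ S, σ x ∈ S := fun x hx => h ▸ mem_image_of_mem _ hx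
  refine (hσ.conj g).axiallySymmetric ?_
  rintro _ ⟨x, hx, rfl⟩
  refine ⟨σ x, hmem x hx, ?_⟩
  show g (σ x) = g (σ (g.symm (g x)))
  rw [g.symm_apply_apply]

lemma image_closedBall_inter_image (φ ψ : X ≃ᵢ X) (p : X) (r : ℝ) (M : Set X) :
    ⇑φ '' closedBall p r ∩ ⇑ψ '' M = ⇑ψ '' (closedBall (ψ.symm (φ p)) r ∩ M) := by
  rw [image_inter ψ.injective, IsometryEquiv.image_closedBall, IsometryEquiv.image_closedBall,
    ψ.apply_symm_apply]

namespace HModel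

variable {j : X → ℝ × ℝ × ℝ} {M : Set X} {p : X} {r : ℝ}

lemma eq_smul_of_zero_subset (hj : HModel j) {n v : ℝ × ℝ × ℝ} (hn : lor n n = 1)
    (h : ∀ x, lor (j x) n = 0 → lor (j x) v = 0) : ∃ c : ℝ, v = c • n := by
  obtain ⟨m, q, hF⟩ := exists_lframe_of_unit hn
  obtain ⟨G, -, -, hGn, hGm, hGq, -⟩ := hj.exists_chart hF
  have key : ∀ b, 0 = b * lor v m + Real.sqrt (1 + b ^ 2) * lor v q := by
    intro b
    have h1 := hF.lor_eq (j (G (0, b))) v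
    rw [h _ (hGn _), hGn, hGm, hGq] at h1
    simpa using h1
  have hq : lor v q = 0 := by simpa using (key 0).symm
  have hm : lor v m = 0 := by simpa [hq] using (key 1).symm
  refine ⟨lor v n, ?_⟩
  conv_lhs => rw [hF.expand v]
  rw [hq, hm]
  simp

lemma axiallySymmetric_closedBall_inter_of_sameBase (hj : HModel j) (p : X) (hr : 0 ≤ r)
    (hM : IsClosed M) (h : TwoHypSameBase M) : AxiallySymmetric (closedBall p r ∩ M) := by
  obtain ⟨B, _, _, -, -, ⟨P, l, hP, hl, hPB, rfl⟩, ⟨Q, l', hQ, hl', hQB, rfl⟩, hfr⟩ := h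
  obtain ⟨n, hn, rfl⟩ := hj.exists_of_isHalfspace hP
  obtain ⟨v, hv, rfl⟩ := hj.exists_of_isHalfspace hQ
  rw [hj.frontier_setOf_le hn] at hPB
  rw [hj.frontier_setOf_le hv] at hQB
  rw [hj.setOf_infDist_halfspace_le hn hl, hj.frontier_setOf_le hn,
    hj.setOf_infDist_halfspace_le hv hl', hj.frontier_setOf_le hv] at hfr
  obtain ⟨c, rfl⟩ := hj.eq_smul_of_zero_subset (v := v) hn fun x hx => by
    have h1 : x ∈ B := hPB ▸ hx
    rw [← hQB] at h1
    exact h1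
  have hfr' : ∀ {x y}, lor (j x) n = lor (j y) n → x ∈ frontier M → y ∈ frontier M := by
    intro x y hxy hx
    rw [hfr, mem_union, mem_ofPred_eq, mem_ofPred_eq, lor_smul_right] at hx ⊢
    rwa [← hxy]
  obtain ⟨m, hm, hmp, hmn⟩ := exists_spacelike_perp_of_causal (v := j p) (w := n)
    (Or.inl (by rw [hj.norm]; norm_num))
  obtain ⟨σ, hσ, -, hs⟩ := hj.exists_reflection_fixing hm
  refine hσ.axiallySymmetric fun x hx => ⟨?_, ?_⟩
  · have h1 := hx.1
    rw [mem_closedBall, hj.dist_le_iff _ _ hr] at h1 ⊢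
    rwa [hs _ hmp]
  · by_cases hxf : x ∈ frontier M
    · exact hM.frontier_subset (hfr' (hs n hmn x).symm hxf)
    · refine subset_of_disjoint_frontier
        (hj.isPreconnected_preimage hn (convex_singleton (lor (j x) n))) (fun z hz hzf => ?_)
        (x := x) rfl hx.2 (hs n hmn x)
      exact hxf (hfr' hz hzf)

lemma exists_ray (hj : HModel j) (p x : X) :
    ∃ f : ℝ → X, Continuous f ∧ f 0 = p ∧ f 1 = x ∧
      ∀ r, 0 < r → dist x p ≤ r → ∀ s ∈ Ico (0 : ℝ) 1, dist (f s) p < r := by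
  obtain ⟨m, hm, hmp⟩ := exists_spacelike_perp (j p)
  obtain ⟨n, c, -, hF⟩ := hj.exists_lframe_of_point hm hmp
  obtain ⟨G, hGc, hGs, hGn, hGm, hGq, hG⟩ := hj.exists_chart hF
  obtain ⟨⟨a, b⟩, rfl⟩ := hGs x
  refine ⟨fun s => G (s * a, s * b), by fun_prop, ?_, by simp, ?_⟩
  · have h1 := hG p
    rw [lor_comm, hF.nq, lor_comm, hF.mq] at h1
    simpa using h1.symm
  · intro r hr hx s hs
    have hc := Real.one_lt_cosh.2 hr.ne'
    rw [hj.dist_le_iff _ _ hr.le, hGq, neg_neg, Real.sqrt_le_left (by linarith)] at hx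
    rw [hj.dist_lt_iff _ _ hr.le, hGq, neg_neg, Real.sqrt_lt' (by linarith)]
    simp only at hx ⊢
    have h1 : s ^ 2 < 1 := by nlinarith [hs.1, hs.2]
    have h2 : 0 < (1 - s ^ 2) * (Real.cosh r ^ 2 - 1) := mul_pos (by linarith) (by nlinarith)
    have h3 := mul_le_mul_of_nonneg_left hx (sq_nonneg s)
    nlinarith

lemma isPreconnected_ball (hj : HModel j) (p : X) (hr : 0 < r) : IsPreconnected (ball p r) := by
  refine isPreconnected_of_forall p fun x hx => ?_
  obtain ⟨f, hf, h0, h1, h⟩ := hj.exists_ray p x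
  refine ⟨f '' Icc 0 1, ?_, ⟨0, by simp, h0⟩, ⟨1, by simp, h1⟩,
    isPreconnected_Icc.image _ hf.continuousOn⟩
  rintro _ ⟨s, hs, rfl⟩
  rcases hs.2.eq_or_lt with rfl | hs1
  · rwa [h1]
  · exact h r hr (mem_ball.1 hx).le s ⟨hs.1, hs1⟩

lemma closedBall_subset_closure_ball (hj : HModel j) (p : X) (hr : 0 < r) :
    closedBall p r ⊆ closure (ball p r) := by
  intro x hx
  obtain ⟨f, hf, -, h1, h⟩ := hj.exists_ray p x
  have ht : Tendsto f (nhdsWithin 1 (Iio 1)) (nhds x) :=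
    h1 ▸ hf.continuousAt.tendsto.mono_left nhdsWithin_le_nhds
  refine mem_closure_of_tendsto ht ?_
  filter_upwards [Ico_mem_nhdsLT (zero_lt_one (α := ℝ))] with s hs
  exact h r hr hx s hs

lemma axiallySymmetric_closedBall (hj : HModel j) (p : X) (hr : 0 ≤ r) :
    AxiallySymmetric (closedBall p r) := by
  obtain ⟨m, hm, hmp⟩ := exists_spacelike_perp (j p)
  obtain ⟨σ, hσ, -, hs⟩ := hj.exists_reflection_fixing hm
  refine hσ.axiallySymmetric fun x hx => ?_
  rw [mem_closedBall, hj.dist_le_iff _ _ hr] at hx ⊢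
  rwa [hs _ hmp]

lemma axiallySymmetric_closedBall_inter_of_farApart (hj : HModel j) (hr : 0 < r)
    (hM : IsClosed M) (h : MultiHypFarApart M r)
    (hint : (interior (closedBall p r ∩ M)).Nonempty) :
    AxiallySymmetric (closedBall p r ∩ M) := by
  obtain ⟨hcomp, -, hfar⟩ := h
  by_cases hball : ∃ y ∈ frontier M, dist y p < r
  · obtain ⟨y, hy, hyp⟩ := hball
    obtain ⟨P, l, hP, hl, hC⟩ := hcomp y hy
    obtain ⟨n, hn, rfl⟩ := hj.exists_of_isHalfspace hP
    rw [hj.setOf_infDist_halfspace_le hn hl, hj.frontier_setOf_le hn] at hC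
    have hfr : ∀ z ∈ frontier M, dist z p ≤ r → lor (j z) n = Real.sinh l := by
      intro z hz hzp
      by_contra hzC
      have hne : connectedComponentIn (frontier M) y ≠ connectedComponentIn (frontier M) z := by
        intro heq
        have h1 := mem_connectedComponentIn hz
        rw [← heq, hC] at h1
        exact hzC h1
      have h1 := (hfar y hy z hz hne).1
      have h2 := dist_triangle_right y z p
      linarith
    have hCM : ∀ z, lor (j z) n = Real.sinh l → z ∈ M := by
      intro z hz
      refine hM.frontier_subset (connectedComponentIn_subset _ y ?_)
      rw [hC]
      exact hz
    obtain ⟨m₀, hm₀, hmp₀, hmn₀⟩ := exists_spacelike_perp_of_causal (v := j p) (w := n)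
      (Or.inl (by rw [hj.norm]; norm_num))
    obtain ⟨c, -, hm⟩ := exists_unit_of_spacelike hm₀
    set m := c • m₀ with hmdef
    have hmp : lor m (j p) = 0 := by rw [hmdef, lor_smul_left, hmp₀, mul_zero]
    have hmn : lor m n = 0 := by rw [hmdef, lor_smul_left, hmn₀, mul_zero]
    obtain ⟨σ, hσ, hneg, hs⟩ := hj.exists_reflection_fixing (m := m) (by rw [hm]; exact one_pos)
    obtain ⟨q, hF⟩ := exists_lframe_of_orthonormal hn hm (by rw [lor_comm, hmn])
    obtain ⟨G, hGc, hGs, hGn, hGm, hGq, hG⟩ := hj.exists_chart hF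
    obtain ⟨o, ho⟩ := hj.surj q hF.qq hF.pos
    refine hσ.axiallySymmetric fun x hx => ⟨?_, ?_⟩
    · have h1 := hx.1
      rw [mem_closedBall, hj.dist_le_iff _ _ hr.le] at h1 ⊢
      rwa [hs _ hmp]
    by_cases hxC : lor (j x) n = Real.sinh l
    · exact hCM _ (by rw [hs n hmn, hxC])
    obtain ⟨⟨t, b⟩, rfl⟩ := hGs x
    have hσx : σ (G (t, b)) = G (t, -b) := by
      rw [hG (σ (G (t, b))), hs n hmn, hneg, hGn, hGm]
    have hpath : IsPreconnected ((fun d => G (t, d)) '' Icc (-|b|) |b|) :=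
      isPreconnected_Icc.image _ (by fun_prop : Continuous fun d => G (t, d)).continuousOn
    refine subset_of_disjoint_frontier hpath ?_
      (mem_image_of_mem _ (abs_le.1 le_rfl)) hx.2
      (hσx ▸ mem_image_of_mem (fun d => G (t, d)) (abs_le.1 (abs_neg b).le))
    rintro _ ⟨d, hd, rfl⟩ hdf
    rw [hGn] at hxC
    refine hxC ?_
    rw [← hfr _ hdf, hGn]
    have h1 := hx.1
    rw [mem_closedBall, hj.dist_le_iff _ _ hr.le, hF.lor_eq (j (G (t, b)))] at h1
    rw [hj.dist_le_iff _ _ hr.le, hF.lor_eq (j (G (t, d)))]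
    rw [hGn, hGm, hGq, lor_comm (j p) m, hmp] at h1 ⊢
    have h2 : Real.sqrt (1 + t ^ 2 + d ^ 2) ≤ Real.sqrt (1 + t ^ 2 + b ^ 2) :=
      Real.sqrt_le_sqrt (by linarith [sq_le_sq.2 (abs_le.2 hd)])
    have h3 : lor (j p) q < 0 := ho ▸ hj.lor_neg p o
    have h4 := mul_le_mul_of_nonpos_right h2 h3.le
    simp only at h1 ⊢
    linarith
  · push Not at hball
    obtain ⟨x, hx⟩ := hint
    obtain ⟨z, hz, hzb⟩ := mem_closure_iff.1
      (hj.closedBall_subset_closure_ball p hr (interior_subset hx).1) _ isOpen_interior hx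
    have h1 : ball p r ⊆ M := subset_of_disjoint_frontier (hj.isPreconnected_ball p hr)
      (fun w hw hwf => absurd (mem_ball.1 hw) (not_lt.2 (hball w hwf))) hzb
      (interior_subset hz).2
    have h2 : closedBall p r ⊆ M :=
      (hj.closedBall_subset_closure_ball p hr).trans (closure_minimal h1 hM)
    rw [inter_eq_left.2 h2]
    exact hj.axiallySymmetric_closedBall p hr.le

lemma axiallySymmetric_of_caseB (hj : HModel j) {K L : Set X} (hK : IsClosed K)
    (hL : IsClosed L) (h : CaseB K L) (φ ψ : X ≃ᵢ X) :
    AxiallySymmetric (⇑φ '' K ∩ ⇑ψ '' L) := by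
  rcases h with ⟨⟨p, r, hr, rfl⟩, h⟩ | ⟨⟨p, r, hr, rfl⟩, h⟩
  · rw [image_closedBall_inter_image]
    exact (hj.axiallySymmetric_closedBall_inter_of_sameBase _ hr.le hL h).image ψ
  · rw [inter_comm, image_closedBall_inter_image]
    exact (hj.axiallySymmetric_closedBall_inter_of_sameBase _ hr.le hK h).image φ

lemma axiallySymmetric_of_caseC (hj : HModel j) {K L : Set X} (hK : IsClosed K)
    (hL : IsClosed L) (h : CaseC K L) (φ ψ : X ≃ᵢ X)
    (hint : (interior (⇑φ '' K ∩ ⇑ψ '' L)).Nonempty) :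
    AxiallySymmetric (⇑φ '' K ∩ ⇑ψ '' L) := by
  have key : ∀ (f g : X ≃ᵢ X) (p : X) (r : ℝ) (A : Set X), 0 < r → IsClosed A →
      MultiHypFarApart A r → (interior (⇑f '' closedBall p r ∩ ⇑g '' A)).Nonempty →
      AxiallySymmetric (⇑f '' closedBall p r ∩ ⇑g '' A) := by
    intro f g p r A hr hA h hint
    rw [image_closedBall_inter_image] at hint ⊢
    change (interior (g.toHomeomorph '' _)).Nonempty at hint
    rw [← g.toHomeomorph.image_interior, image_nonempty] at hint
    exact (hj.axiallySymmetric_closedBall_inter_of_farApart hr hA h hint).image g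
  rcases h with ⟨p, r, hr, rfl, h⟩ | ⟨p, r, hr, rfl, h⟩
  · exact key φ ψ p r L hr hL h hint
  · rw [inter_comm] at hint ⊢
    exact key ψ φ p r K hr hK h hint

end HModel

/-- **Lemma 5.2.** In the hyperbolic plane, if the pair of proper closed convex sets
`K`, `L` with interior points falls into one of the cases (A)–(E), then every
intersection of congruent copies of `K` and `L` (by orientation preserving
congruences, with nonempty interior) is axially symmetric. -/
theorem lemma5_2
    (X : Type*) [MetricSpace X] (hX : IsHyperbolicSpace X 2)
    (K L : Set X)
    (hKcl : IsClosed K) (hLcl : IsClosed L)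
    (hKcv : GConvex K) (hLcv : GConvex L)
    (hKint : (interior K).Nonempty) (hLint : (interior L).Nonempty)
    (hKpr : K ≠ univ) (hLpr : L ≠ univ)
    (hcases : Theorem5Cases K L) :
    T5Cond2 K L := by
  obtain ⟨j, hj⟩ := hX.exists_hmodel
  intro φ ψ _ _ hint
  rcases hcases with h | h | h | h | h
  · exact hj.axiallySymmetric_of_caseA h φ ψ
  · exact hj.axiallySymmetric_of_caseB hKcl hLcl h φ ψ
  · exact hj.axiallySymmetric_of_caseC hKcl hLcl h φ ψ hint
  · exact hj.axiallySymmetric_of_caseD h φ ψ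
  · exact hj.axiallySymmetric_of_caseE h φ ψ

end BallChar
end
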